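/- For h ≥ 2, the defining ideal of the projective closure of the Arslan curve C(h(h+1), h(h+1)+1, (h+1)^2, (h+1)^2+1) in R = k[x_0,...,x_4] has a minimal graded free resolution of the form 0 → R^{2h−1} → R^{4h+1} → R^{2h+3} → R → R/I → 0; in particular its Betti numbers are 2h+3, 4h+1, 2h−1, the projective dimension of R/I is 3, and the Cohen–Macaulay type is 2h−1, an unbounded function of h. -/

import Mathlib

set_option maxHeartbeats 1000000
set_option synthInstance.maxHeartbeats 400000

open MvPolynomial

namespace Arslan

lemma ker_le_of_monomial {k σ ρ : Type*} [Field k]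
    (τ : MvPolynomial σ k →ₐ[k] MvPolynomial ρ k) (g : (σ →₀ ℕ) → (ρ →₀ ℕ))
    (hg : ∀ m, τ (monomial m 1) = monomial (g m) 1) (J : Ideal (MvPolynomial σ k))
    (hJ : ∀ m m', g m = g m' → (monomial m 1 : MvPolynomial σ k) - monomial m' 1 ∈ J)
    (f : MvPolynomial σ k) (hf : τ f = 0) : f ∈ J := by
  classical
  let L : MvPolynomial ρ k →ₗ[k] MvPolynomial σ k :=
    (basisMonomials ρ k).constr k (fun v => monomial (Function.invFun g v) 1)
  have hL : ∀ v, L (monomial v 1) = monomial (Function.invFun g v) 1 := by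
    intro v
    have := (basisMonomials ρ k).constr_basis k
      (fun v => (monomial (Function.invFun g v) 1 : MvPolynomial σ k)) v
    rwa [coe_basisMonomials] at this
  have key : ∀ f : MvPolynomial σ k, f - L (τ f) ∈ J := by
    intro f
    induction f using MvPolynomial.induction_on' with
    | monomial u a =>
      have h1 : (monomial u a : MvPolynomial σ k) = a • monomial u 1 := by
        rw [smul_monomial]; simp
      rw [h1, map_smul, map_smul, hg, hL, ← smul_sub, smul_eq_C_mul]
      apply J.mul_mem_left
      apply hJ
      exact (Function.invFun_eq (f := g) ⟨u, rfl⟩).symm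
    | add p q hp hq =>
      rw [map_add, map_add, add_sub_add_comm]
      exact J.add_mem hp hq
  have := key f
  rwa [hf, map_zero, sub_zero] at this

section Mon
variable {B : Type*} [CommRing B] (x0 x1 x2 x3 x4 : B)

lemma quad_aux (hq : x1 * x4 = x2 * x3) {m1 m2 m3 m4 n1 n2 n3 n4 : ℕ} (hle : m2 ≤ n2)
    (e1 : m1 + m2 = n1 + n2) (e2 : m3 + m4 = n3 + n4) (e3 : m2 + m4 = n2 + n4) :
    x1 ^ m1 * x2 ^ m2 * x3 ^ m3 * x4 ^ m4 = x1 ^ n1 * x2 ^ n2 * x3 ^ n3 * x4 ^ n4 := by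
  obtain ⟨e, rfl⟩ := Nat.exists_eq_add_of_le hle
  obtain rfl : m1 = n1 + e := by omega
  obtain rfl : m4 = n4 + e := by omega
  obtain rfl : n3 = m3 + e := by omega
  calc _ = x1 ^ n1 * x2 ^ m2 * x3 ^ m3 * x4 ^ n4 * (x1 * x4) ^ e := by ring
    _ = _ := by rw [hq]; ring

lemma quad (hq : x1 * x4 = x2 * x3) {m1 m2 m3 m4 n1 n2 n3 n4 : ℕ}
    (e1 : m1 + m2 = n1 + n2) (e2 : m3 + m4 = n3 + n4) (e3 : m2 + m4 = n2 + n4) :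
    x1 ^ m1 * x2 ^ m2 * x3 ^ m3 * x4 ^ m4 = x1 ^ n1 * x2 ^ n2 * x3 ^ n3 * x4 ^ n4 := by
  rcases le_total m2 n2 with h | h
  · exact quad_aux x1 x2 x3 x4 hq h e1 e2 e3
  · exact (quad_aux x1 x2 x3 x4 hq h e1.symm e2.symm e3.symm).symm

/-- canonical monomial -/
def Mon (m0 p r d : ℕ) : B :=
  x0 ^ m0 * (x1 ^ (p - min p d) * x2 ^ (min p d) * x3 ^ (r - (d - min p d)) *
    x4 ^ (d - min p d))

lemma mon_eq (hq : x1 * x4 = x2 * x3) (m0 m1 m2 m3 m4 p r d : ℕ)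
    (hp : p = m1 + m2) (hr : r = m3 + m4) (hd : d = m2 + m4) :
    Mon x0 x1 x2 x3 x4 m0 p r d =
      x0 ^ m0 * (x1 ^ m1 * x2 ^ m2 * x3 ^ m3 * x4 ^ m4) := by
  unfold Mon
  rw [quad x1 x2 x3 x4 hq (n1 := m1) (n2 := m2) (n3 := m3) (n4 := m4)] <;> omega

lemma exists_exp (p r d : ℕ) (h : d ≤ p + r) :
    ∃ z1 z2 z3 z4 : ℕ, p = z1 + z2 ∧ r = z3 + z4 ∧ d = z2 + z4 :=
  ⟨p - min p d, min p d, r - (d - min p d), d - min p d, by omega, by omega, by omega⟩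

variable (h : ℕ) (hq : x1 * x4 = x2 * x3)
  (hF : ∀ i ≤ h, x1 ^ (h - i) * x3 ^ (i + 1) = x2 ^ (h + 1 - i) * x4 ^ i)
  (hG : ∀ j ≤ h, x0 * x3 ^ j * x4 ^ (h - j) = x1 ^ (j + 1) * x2 ^ (h - j))

include hq hF in
lemma moveF (m0 p r d : ℕ) (hd : h + 1 ≤ d) (hdp : d ≤ p + 1 + r) :
    Mon x0 x1 x2 x3 x4 m0 (p + 1) r d = Mon x0 x1 x2 x3 x4 m0 p (r + 1) (d - (h + 1)) := by
  obtain ⟨i, hi, hir, hip⟩ : ∃ i, i ≤ h ∧ i ≤ r ∧ h - i ≤ p := ⟨min r h, by omega, by omega, by omega⟩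
  obtain ⟨z1, z2, z3, z4, e1, e2, e3⟩ := exists_exp (p - (h - i)) (r - i) (d - (h + 1)) (by omega)
  rw [mon_eq x0 x1 x2 x3 x4 hq m0 z1 (z2 + (h + 1 - i)) z3 (z4 + i) _ _ _
    (by omega) (by omega) (by omega),
    mon_eq x0 x1 x2 x3 x4 hq m0 (z1 + (h - i)) z2 (z3 + (i + 1)) z4 _ _ _
    (by omega) (by omega) (by omega)]
  have := hF i hi
  simp only [pow_add _ z1 (h - i), pow_add _ z2 (h + 1 - i), pow_add _ z3 (i + 1), pow_add _ z4 i]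
  linear_combination (- x0 ^ m0 * (x1 ^ z1 * x2 ^ z2 * x3 ^ z3 * x4 ^ z4)) * this

include hq hG in
lemma moveG (m0 p r d : ℕ) (hr : h ≤ r) (hdp : d ≤ p + r) :
    Mon x0 x1 x2 x3 x4 (m0 + 1) p r d = Mon x0 x1 x2 x3 x4 m0 (p + h + 1) (r - h) d := by
  -- choose j with h - j ≤ d and j ≤ c
  obtain ⟨j, hj, hjd, hjc⟩ : ∃ j, j ≤ h ∧ h - j ≤ d ∧ j ≤ p + r - d :=
    ⟨min h (p + r - d), by omega, by omega, by omega⟩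
  obtain ⟨z1, z2, z3, z4, e1, e2, e3⟩ := exists_exp p (r - h) (d - (h - j)) (by omega)
  rw [mon_eq x0 x1 x2 x3 x4 hq (m0 + 1) z1 z2 (z3 + j) (z4 + (h - j)) _ _ _
    (by omega) (by omega) (by omega),
    mon_eq x0 x1 x2 x3 x4 hq m0 (z1 + (j + 1)) (z2 + (h - j)) z3 z4 _ _ _
    (by omega) (by omega) (by omega)]
  have := hG j hj
  simp only [pow_add _ z1 (j + 1), pow_add _ z2 (h - j), pow_add _ z3 j, pow_add _ z4 (h - j),
    pow_succ x0]
  linear_combination (x0 ^ m0 * (x1 ^ z1 * x2 ^ z2 * x3 ^ z3 * x4 ^ z4)) * this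

lemma nf_unique_big (h m0 p r d m0' p' r' d' : ℕ)
    (N : m0 + p + r = m0' + p' + r')
    (T : (h + 1) * (h * (p + r) + r) + d = (h + 1) * (h * (p' + r') + r') + d')
    (hd : d ≤ p + r) (hd' : d' ≤ p' + r')
    (a1 : p = 0 ∨ d ≤ h) (a2 : m0 = 0 ∨ r < h) (b1 : p' = 0 ∨ d' ≤ h) (b2 : m0' = 0 ∨ r' < h)
    (big : h < d) :
    m0 = m0' ∧ p = p' ∧ r = r' ∧ d = d' := by
  have hp : p = 0 := by omega
  have hm : m0 = 0 := by omega
  subst hp hm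
  obtain rfl : r = m0' + p' + r' := by omega
  have h1 : d' = d + (h + 1) * ((h + 1) * m0' + p') := by nlinarith
  have h2 : d ≤ d' := by rw [h1]; exact Nat.le_add_right _ _
  have hp : p' = 0 := by omega
  have hm : m0' = 0 := by omega
  subst hp hm
  simp at h1 ⊢
  omega

lemma nf_unique_mix (h m0 p r m0' p' r' : ℕ) 
    (N : m0 + p + r = m0' + p' + r')
    (K : (h * (p + r) + r) = (h * (p' + r') + r'))
    (a2 : m0 = 0) (b2 : r' < h) :
    m0 = m0' ∧ p = p' ∧ r = r' := by
  have h0 : m0' = 0 := by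
    by_contra hne
    have : p' + r' + 1 ≤ p + r := by omega
    have := Nat.mul_le_mul_left h this
    rw [mul_add] at this
    omega
  have : p + r = p' + r' := by omega
  rw [this] at K
  omega

lemma nf_unique (h m0 p r d m0' p' r' d' : ℕ) (hh : 0 < h)
    (N : m0 + p + r = m0' + p' + r')
    (T : (h + 1) * (h * (p + r) + r) + d = (h + 1) * (h * (p' + r') + r') + d')
    (hd : d ≤ p + r) (hd' : d' ≤ p' + r')
    (a1 : p = 0 ∨ d ≤ h) (a2 : m0 = 0 ∨ r < h) (b1 : p' = 0 ∨ d' ≤ h) (b2 : m0' = 0 ∨ r' < h) :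
    m0 = m0' ∧ p = p' ∧ r = r' ∧ d = d' := by
  by_cases big : h < d
  · exact nf_unique_big h m0 p r d m0' p' r' d' N T hd hd' a1 a2 b1 b2 big
  by_cases big' : h < d'
  · obtain ⟨a, b, c, d⟩ := nf_unique_big h m0' p' r' d' m0 p r d N.symm T.symm hd' hd b1 b2 a1 a2 big'
    exact ⟨a.symm, b.symm, c.symm, d.symm⟩
  have hdd : d = d' := by
    have := congrArg (· % (h + 1)) T
    simpa [Nat.mul_add_mod, Nat.mod_eq_of_lt (show d < h + 1 by omega),
      Nat.mod_eq_of_lt (show d' < h + 1 by omega)] using this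
  subst hdd
  have K : (h * (p + r) + r) = (h * (p' + r') + r') :=
    Nat.eq_of_mul_eq_mul_left (Nat.succ_pos h) (Nat.add_right_cancel T)
  rcases a2 with a2 | a2
  · rcases b2 with b2 | b2
    · have : p + r = p' + r' := by omega
      rw [this] at K
      omega
    · obtain ⟨a, b, c⟩ := nf_unique_mix h m0 p r m0' p' r' N K a2 b2
      exact ⟨a, b, c, rfl⟩
  · rcases b2 with b2 | b2
    · obtain ⟨a, b, c⟩ := nf_unique_mix h m0' p' r' m0 p r N.symm K.symm b2 a2
      exact ⟨a.symm, b.symm, c.symm, rfl⟩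
    · have hr : r = r' := by
        have := congrArg (· % h) K
        simpa [Nat.mul_add_mod, Nat.mod_eq_of_lt a2, Nat.mod_eq_of_lt b2] using this
      subst hr
      have := Nat.eq_of_mul_eq_mul_left hh (Nat.add_right_cancel K)
      omega

include hq hF hG in
lemma mon_unique (hh : 0 < h) (n : ℕ) : ∀ (m0 p r d m0' p' r' d' : ℕ),
    m0 + d + m0' + d' ≤ n →
    m0 + p + r = m0' + p' + r' →
    (h + 1) * (h * (p + r) + r) + d = (h + 1) * (h * (p' + r') + r') + d' →
    d ≤ p + r → d' ≤ p' + r' →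
    Mon x0 x1 x2 x3 x4 m0 p r d = Mon x0 x1 x2 x3 x4 m0' p' r' d' := by
  induction n using Nat.strong_induction_on with
  | _ n ih =>
  have half : ∀ (m0 p r d m0' p' r' d' : ℕ),
    m0 + d + m0' + d' ≤ n →
    m0 + p + r = m0' + p' + r' →
    (h + 1) * (h * (p + r) + r) + d = (h + 1) * (h * (p' + r') + r') + d' →
    d ≤ p + r → d' ≤ p' + r' → ¬ ((p = 0 ∨ d ≤ h) ∧ (m0 = 0 ∨ r < h)) →
    Mon x0 x1 x2 x3 x4 m0 p r d = Mon x0 x1 x2 x3 x4 m0' p' r' d' := by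
    intro m0 p r d m0' p' r' d' hn N T hd hd' hnot
    by_cases c1 : p = 0 ∨ d ≤ h
    · have c2 : ¬ (m0 = 0 ∨ r < h) := fun c => hnot ⟨c1, c⟩
      obtain ⟨m0, rfl⟩ : ∃ m, m0 = m + 1 := ⟨m0 - 1, by omega⟩
      rw [moveG x0 x1 x2 x3 x4 h hq hG m0 p r d (by omega) hd]
      obtain ⟨r, rfl⟩ : ∃ s, r = s + h := ⟨r - h, by omega⟩
      refine ih (m0 + d + m0' + d') (by omega) _ _ _ _ _ _ _ _ le_rfl (by omega) ?_ (by omega) hd'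
      rw [← T, Nat.add_sub_cancel]
      ring
    · obtain ⟨p, rfl⟩ : ∃ m, p = m + 1 := ⟨p - 1, by omega⟩
      rw [moveF x0 x1 x2 x3 x4 h hq hF m0 p r d (by omega) hd]
      obtain ⟨d, rfl⟩ : ∃ s, d = s + (h + 1) := ⟨d - (h + 1), by omega⟩
      refine ih (m0 + d + m0' + d') (by omega) _ _ _ _ _ _ _ _ (by omega) (by omega) ?_ (by omega) hd'
      rw [← T, Nat.add_sub_cancel]
      ring
  intro m0 p r d m0' p' r' d' hn N T hd hd'
  by_cases c : ((p = 0 ∨ d ≤ h) ∧ (m0 = 0 ∨ r < h))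
  · by_cases c' : ((p' = 0 ∨ d' ≤ h) ∧ (m0' = 0 ∨ r' < h))
    · obtain ⟨rfl, rfl, rfl, rfl⟩ := nf_unique h m0 p r d m0' p' r' d' hh N T hd hd' c.1 c.2 c'.1 c'.2
      rfl
    · exact (half m0' p' r' d' m0 p r d (by omega) N.symm T.symm hd' hd c').symm
  · exact half m0 p r d m0' p' r' d' hn N T hd hd' c

end Mon

lemma monomial_five {k : Type*} [Field k] (m : Fin 5 →₀ ℕ) :
    (monomial m 1 : MvPolynomial (Fin 5) k) =
      X 0 ^ m 0 * (X 1 ^ m 1 * X 2 ^ m 2 * X 3 ^ m 3 * X 4 ^ m 4) := by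
  rw [monomial_eq, Finsupp.prod_fintype _ _ (by simp)]
  simp [Fin.prod_univ_succ]
  ring

end Arslan

namespace Arslan

lemma toric_ker {k : Type*} [Field k] (h : ℕ) (hh : 0 < h) (J : Ideal (MvPolynomial (Fin 5) k))
    (hq : (X 1 * X 4 - X 2 * X 3 : MvPolynomial (Fin 5) k) ∈ J)
    (hF : ∀ i ≤ h, (X 1 ^ (h - i) * X 3 ^ (i + 1) - X 2 ^ (h + 1 - i) * X 4 ^ i :
      MvPolynomial (Fin 5) k) ∈ J)
    (hG : ∀ j ≤ h, (X 0 * X 3 ^ j * X 4 ^ (h - j) - X 1 ^ (j + 1) * X 2 ^ (h - j) :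
      MvPolynomial (Fin 5) k) ∈ J)
    (τ : MvPolynomial (Fin 5) k →ₐ[k] MvPolynomial (Fin 2) k)
    (t0 : τ (X 0) = X 0 ^ ((h + 1) ^ 2 + 1))
    (t1 : τ (X 1) = X 0 ^ (h + 2) * X 1 ^ (h * (h + 1)))
    (t2 : τ (X 2) = X 0 ^ (h + 1) * X 1 ^ (h * (h + 1) + 1))
    (t3 : τ (X 3) = X 0 * X 1 ^ ((h + 1) ^ 2))
    (t4 : τ (X 4) = X 1 ^ ((h + 1) ^ 2 + 1))
    (f : MvPolynomial (Fin 5) k) (hf : τ f = 0) : f ∈ J := by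
  refine ker_le_of_monomial τ (fun m =>
    Finsupp.single 0 (((h + 1) ^ 2 + 1) * m 0 + (h + 2) * m 1 + (h + 1) * m 2 + m 3) +
    Finsupp.single 1 ((h * (h + 1)) * m 1 + (h * (h + 1) + 1) * m 2 + ((h + 1) ^ 2) * m 3 +
      ((h + 1) ^ 2 + 1) * m 4)) ?_ J ?_ f hf
  · intro m
    rw [monomial_five, ← mul_one (1 : k), ← monomial_mul, ← X_pow_eq_monomial, ← X_pow_eq_monomial]
    simp only [map_mul, map_pow, t0, t1, t2, t3, t4]
    ring
  · intro m m' e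
    have e0 := DFunLike.congr_fun e 0
    have e1 := DFunLike.congr_fun e 1
    simp at e0 e1
    rw [← Ideal.Quotient.eq, monomial_five, monomial_five]
    simp only [map_mul, map_pow]
    have Q := (Ideal.Quotient.eq.2 hq)
    have F := fun i hi => (Ideal.Quotient.eq.2 (hF i hi))
    have G := fun i hi => (Ideal.Quotient.eq.2 (hG i hi))
    simp only [map_mul, map_pow] at Q F G
    rw [← mon_eq _ _ _ _ _ Q _ _ _ _ _ _ _ _ rfl rfl rfl,
      ← mon_eq _ _ _ _ _ Q _ _ _ _ _ _ _ _ rfl rfl rfl]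
    have N : ((h + 1) ^ 2 + 1) * (m 0 + (m 1 + m 2) + (m 3 + m 4)) =
        ((h + 1) ^ 2 + 1) * (m' 0 + (m' 1 + m' 2) + (m' 3 + m' 4)) := by
      linear_combination e0 + e1
    refine mon_unique _ _ _ _ _ h Q F G hh _ _ _ _ _ _ _ _ _ le_rfl
      (Nat.eq_of_mul_eq_mul_left (Nat.succ_pos _) N) ?_ (by omega) (by omega)
    linear_combination e1

/-- Segre map -/
noncomputable def seg (k : Type*) [Field k] : MvPolynomial (Fin 5) k →ₐ[k] MvPolynomial (Fin 5) k :=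
  aeval ![X 0, X 1 * X 3, X 1 * X 4, X 2 * X 3, X 2 * X 4]

section
variable {k : Type*} [Field k]
@[simp] lemma seg0 : seg k (X 0) = X 0 := by simp [seg]
@[simp] lemma seg1 : seg k (X 1) = X 1 * X 3 := by simp [seg]
@[simp] lemma seg2 : seg k (X 2) = X 1 * X 4 := by simp [seg]
@[simp] lemma seg3 : seg k (X 3) = X 2 * X 3 := by simp [seg]
@[simp] lemma seg4 : seg k (X 4) = X 2 * X 4 := by simp [seg]

/-- quadric -/
noncomputable def Q (k : Type*) [Field k] : MvPolynomial (Fin 5) k := X 1 * X 4 - X 2 * X 3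

lemma seg_Q : seg k (Q k) = 0 := by simp [Q]; ring

lemma seg_monomial (m : Fin 5 →₀ ℕ) : seg k (monomial m 1) =
    X 0 ^ m 0 * (X 1 ^ (m 1 + m 2) * X 2 ^ (m 3 + m 4) * X 3 ^ (m 1 + m 3) * X 4 ^ (m 2 + m 4)) := by
  rw [monomial_five]
  simp only [map_mul, map_pow, seg0, seg1, seg2, seg3, seg4]
  ring

/-- exponent vector -/
noncomputable def vec (a b c d e : ℕ) : Fin 5 →₀ ℕ :=
  Finsupp.equivFunOnFinite.symm ![a, b, c, d, e]

lemma seg_ker (f : MvPolynomial (Fin 5) k) (hf : seg k f = 0) : ∃ y, f = y * Q k := by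
  have : f ∈ Ideal.span {Q k} := by
    refine ker_le_of_monomial (seg k) (fun m =>
      vec (m 0) (m 1 + m 2) (m 3 + m 4) (m 1 + m 3) (m 2 + m 4)) ?_ _ ?_ f hf
    · intro m
      rw [seg_monomial, monomial_five]
      simp [vec]
    · intro m m' e
      have e0 := DFunLike.congr_fun e 0
      have e1 := DFunLike.congr_fun e 1
      have e2 := DFunLike.congr_fun e 2
      have e3 := DFunLike.congr_fun e 3
      have e4 := DFunLike.congr_fun e 4
      simp [vec] at e0 e1 e2 e3 e4
      have hq : (X 1 * X 4 - X 2 * X 3 : MvPolynomial (Fin 5) k) ∈ Ideal.span {Q k} :=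
        Ideal.subset_span rfl
      rw [← Ideal.Quotient.eq, monomial_five, monomial_five, e0]
      simp only [map_mul, map_pow]
      have QQ := (Ideal.Quotient.eq.2 hq)
      simp only [map_mul] at QQ
      rw [quad _ _ _ _ QQ e1 e2 e4]
  obtain ⟨y, hy⟩ := Ideal.mem_span_singleton'.1 this
  exact ⟨y, hy.symm⟩

/-- Setting two variables to zero. -/
noncomputable def kill (i j : Fin 5) : MvPolynomial (Fin 5) k →ₐ[k] MvPolynomial (Fin 5) k :=
  aeval (fun l => if l = i ∨ l = j then 0 else X l)

lemma sub_kill_mem (i j : Fin 5) (f : MvPolynomial (Fin 5) k) :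
    ∃ p r, f - kill i j f = X i * p + X j * r := by
  have hmem : f - kill i j f ∈ Ideal.span {(X i : MvPolynomial (Fin 5) k), X j} := by
    rw [← Ideal.Quotient.eq]
    have : (Ideal.Quotient.mkₐ k (Ideal.span {(X i : MvPolynomial (Fin 5) k), X j})) =
      (Ideal.Quotient.mkₐ k (Ideal.span {(X i : MvPolynomial (Fin 5) k), X j})).comp (kill i j) := by
      apply MvPolynomial.algHom_ext
      intro l
      simp only [kill, AlgHom.comp_apply, aeval_X, Ideal.Quotient.mkₐ_eq_mk]
      split_ifs with hl
      · rw [map_zero, Ideal.Quotient.eq_zero_iff_mem]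
        rcases hl with rfl | rfl
        · exact Ideal.subset_span (by simp)
        · exact Ideal.subset_span (by simp)
      · rfl
    exact DFunLike.congr_fun this f
  obtain ⟨p, r, e⟩ := Ideal.mem_span_pair.1 hmem
  exact ⟨p, r, by rw [← e]; ring⟩

lemma kill_kill (i j : Fin 5) (f : MvPolynomial (Fin 5) k) : kill i j (kill i j f) = kill i j f := by
  have : (kill i j : MvPolynomial (Fin 5) k →ₐ[k] _).comp (kill i j) = kill i j := by
    apply MvPolynomial.algHom_ext
    intro l
    simp only [kill, AlgHom.comp_apply, aeval_X]
    split_ifs with hl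
    · simp
    · simp [hl]
  exact DFunLike.congr_fun this f

lemma dvd_aux (i j l l' : Fin 5) (hl : l' ≠ l)
    (hQ : kill i j (Q k) = 0)
    (hcomp : (kill l l : MvPolynomial (Fin 5) k →ₐ[k] _).comp (seg k) = (seg k).comp (kill i j))
    (n : ℕ) (f : MvPolynomial (Fin 5) k) (hf : X l ∣ seg k f * X l' ^ n) :
    ∃ p r, f = X i * p + X j * r := by
  obtain ⟨w, hw⟩ := hf
  have h1 := congrArg (kill l l) hw
  rw [map_mul, map_mul, map_pow] at h1
  have h2 : kill l l (X l : MvPolynomial (Fin 5) k) = 0 := by simp [kill]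
  have h3 : kill l l (X l' : MvPolynomial (Fin 5) k) = X l' := by simp [kill, hl]
  rw [h2, h3, zero_mul] at h1
  have h4 := (mul_eq_zero.1 h1).resolve_right (pow_ne_zero _ (X_ne_zero _))
  have h5 : seg k (kill i j f) = 0 := by
    rw [← h4]; exact (DFunLike.congr_fun hcomp f).symm
  obtain ⟨y, hy⟩ := seg_ker _ h5
  have h6 : kill i j f = 0 := by
    rw [← kill_kill, hy, map_mul, hQ, mul_zero]
  obtain ⟨p, r, e⟩ := sub_kill_mem i j f
  rw [h6, sub_zero] at e
  exact ⟨p, r, e⟩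

lemma dvd_a (n : ℕ) (f : MvPolynomial (Fin 5) k) (hf : X 1 ∣ seg k f * X 2 ^ n) :
    ∃ p r, f = X 1 * p + X 2 * r := by
  refine dvd_aux 1 2 1 2 (by decide) (by simp [kill, Q]) ?_ n f hf
  apply MvPolynomial.algHom_ext
  intro l
  fin_cases l <;> simp [kill]

lemma dvd_d (n : ℕ) (f : MvPolynomial (Fin 5) k) (hf : X 4 ∣ seg k f * X 3 ^ n) :
    ∃ p r, f = X 2 * p + X 4 * r := by
  refine dvd_aux 2 4 4 3 (by decide) (by simp [kill, Q]) ?_ n f hf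
  apply MvPolynomial.algHom_ext
  intro l
  fin_cases l <;> simp [kill]

end
end Arslan

namespace Arslan

section Hm
variable {R P : Type*} [CommRing R] [CommRing P] (π : R →+* P)

/-- Degree `n` homogeneous evaluation of a univariate polynomial. -/
noncomputable def Hm (n : ℕ) (α β : P) (u : Polynomial R) : P :=
  ∑ i ∈ Finset.range (n + 1), π (u.coeff i) * α ^ (n - i) * β ^ i

lemma Hm_add (n : ℕ) (α β : P) (u v : Polynomial R) :
    Hm π n α β (u + v) = Hm π n α β u + Hm π n α β v := by
  simp [Hm, add_mul, Finset.sum_add_distrib]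

lemma Hm_sub (n : ℕ) (α β : P) (u v : Polynomial R) :
    Hm π n α β (u - v) = Hm π n α β u - Hm π n α β v := by
  simp [Hm, sub_mul, Finset.sum_sub_distrib]

lemma Hm_C_mul (n : ℕ) (α β : P) (c : R) (u : Polynomial R) :
    Hm π n α β (Polynomial.C c * u) = π c * Hm π n α β u := by
  simp [Hm, Finset.mul_sum, mul_assoc]

lemma Hm_X_mul (n : ℕ) (α β : P) (u : Polynomial R) :
    Hm π (n + 1) α β (Polynomial.X * u) = β * Hm π n α β u := by
  unfold Hm
  rw [Finset.sum_range_succ']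
  simp only [Polynomial.coeff_X_mul, Polynomial.coeff_X_mul_zero, map_zero, zero_mul, add_zero,
    Finset.mul_sum, Nat.add_sub_add_right]
  refine Finset.sum_congr rfl fun i _ => ?_
  ring

lemma Hm_succ (n : ℕ) (α β : P) (u : Polynomial R) (hu : u.coeff (n + 1) = 0) :
    Hm π (n + 1) α β u = α * Hm π n α β u := by
  unfold Hm
  rw [Finset.sum_range_succ, hu]
  simp only [map_zero, zero_mul, add_zero, Finset.mul_sum]
  refine Finset.sum_congr rfl fun i hi => ?_
  have : n + 1 - i = (n - i) + 1 := by simp at hi; omega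
  rw [this]
  ring

lemma Hm_X_pow (n : ℕ) (α β : P) (i : ℕ) (hi : i ≤ n) :
    Hm π n α β (Polynomial.X ^ i) = α ^ (n - i) * β ^ i := by
  unfold Hm
  rw [Finset.sum_eq_single i]
  · simp
  · intro j _ hj
    simp [Polynomial.coeff_X_pow, hj]
  · intro h
    simp at h
    omega

/-- Linear form `y - z T`. -/
noncomputable def lin (y z : R) : Polynomial R := Polynomial.C y - Polynomial.C z * Polynomial.X

lemma Hm_lin (n : ℕ) (α β : P) (y z : R) (u : Polynomial R) (hu : u.coeff (n + 1) = 0) :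
    Hm π (n + 1) α β (lin y z * u) = (π y * α - π z * β) * Hm π n α β u := by
  have : lin y z * u = Polynomial.C y * u - Polynomial.C z * (Polynomial.X * u) := by
    unfold lin; ring
  rw [this, Hm_sub, Hm_C_mul, Hm_C_mul, Hm_X_mul, Hm_succ _ _ _ _ _ hu]
  ring

lemma lin_mul_coeff (n : ℕ) (y z : R) (u : Polynomial R) (hu : ∀ i, n ≤ i → u.coeff i = 0) :
    ∀ i, n + 1 ≤ i → (lin y z * u).coeff i = 0 := by
  intro i hi
  obtain ⟨i, rfl⟩ : ∃ j, i = j + 1 := ⟨i - 1, by omega⟩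
  have : lin y z * u = Polynomial.C y * u - Polynomial.C z * (Polynomial.X * u) := by
    unfold lin; ring
  rw [this, Polynomial.coeff_sub, Polynomial.coeff_C_mul, Polynomial.coeff_C_mul,
    Polynomial.coeff_X_mul, hu _ (by omega), hu _ (by omega)]
  simp

lemma lin_mul_mem (m : Ideal R) (y z : R) (hy : y ∈ m) (hz : z ∈ m) (u : Polynomial R) (i : ℕ) :
    (lin y z * u).coeff i ∈ m := by
  have : lin y z * u = Polynomial.C y * u - Polynomial.C z * (Polynomial.X * u) := by
    unfold lin; ring
  rw [this, Polynomial.coeff_sub, Polynomial.coeff_C_mul, Polynomial.coeff_C_mul]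
  exact m.sub_mem (m.mul_mem_right _ hy) (m.mul_mem_right _ hz)

variable {π}

/-- Exactness of the truncated Koszul complex at the generators. -/
lemma koszul_one [IsDomain P] {y1 y2 y3 y4 : R} {α β : P} (hα : α ≠ 0)
    (h13 : π y3 * α = π y1 * β) (h24 : π y4 * α = π y2 * β)
    (hker : ∀ f, π f = 0 → ∃ y, f = y * (y1 * y4 - y2 * y3))
    (hdvd : ∀ n f, α ∣ π f * β ^ n → ∃ p r, f = y1 * p + y2 * r) (n : ℕ) :
    ∀ u : Polynomial R, (∀ i, n + 1 ≤ i → u.coeff i = 0) → Hm π n α β u = 0 →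
    ∃ p r : Polynomial R, (∀ i, max n 1 ≤ i → p.coeff i = 0) ∧
      (∀ i, max n 1 ≤ i → r.coeff i = 0) ∧ u = lin y3 y1 * p + lin y4 y2 * r := by
  induction n with
  | zero =>
    intro u hu h0
    obtain ⟨y, hy⟩ := hker (u.coeff 0) (by simpa [Hm] using h0)
    have hu' : u = Polynomial.C (u.coeff 0) := by
      ext i
      rcases i with _ | i
      · simp
      · rw [hu _ (by omega), Polynomial.coeff_C_succ]
    refine ⟨Polynomial.C (-(y2 * y)), Polynomial.C (y1 * y), ?_, ?_, ?_⟩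
    · intro i hi
      obtain ⟨i, rfl⟩ : ∃ j, i = j + 1 := ⟨i - 1, by omega⟩
      exact Polynomial.coeff_C_succ
    · intro i hi
      obtain ⟨i, rfl⟩ : ∃ j, i = j + 1 := ⟨i - 1, by omega⟩
      exact Polynomial.coeff_C_succ
    · rw [hu', hy]
      simp only [lin, map_mul, map_sub, map_neg]
      ring
  | succ n ih =>
    intro u hu h0
    obtain ⟨p0, r0, hpr⟩ := hdvd (n + 1) (u.coeff (n + 1)) (by
      have h1 : Hm π (n + 1) α β u = (∑ i ∈ Finset.range (n + 1),
        π (u.coeff i) * α ^ (n + 1 - i) * β ^ i) + π (u.coeff (n + 1)) * β ^ (n + 1) := by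
        unfold Hm
        rw [Finset.sum_range_succ]
        simp
      rw [h0] at h1
      rw [← sub_eq_iff_eq_add', zero_sub] at h1
      rw [← h1, dvd_neg]
      refine Finset.dvd_sum fun i hi => ?_
      apply Dvd.dvd.mul_right
      apply Dvd.dvd.mul_left
      apply dvd_pow_self
      simp at hi; omega)
    have hX : ∀ c : R, ∀ i, n + 1 ≤ i → (Polynomial.C c * Polynomial.X ^ n).coeff i = 0 := by
      intro c i hi
      rw [Polynomial.coeff_C_mul_X_pow, if_neg (by omega)]
    set u' := u + lin y3 y1 * (Polynomial.C p0 * Polynomial.X ^ n) +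
      lin y4 y2 * (Polynomial.C r0 * Polynomial.X ^ n) with hu'
    have e1 : Hm π (n + 1) α β u' = 0 := by
      rw [hu', Hm_add, Hm_add, h0, Hm_lin _ _ _ _ _ _ _ (hX _ _ le_rfl),
        Hm_lin _ _ _ _ _ _ _ (hX _ _ le_rfl), h13, h24]
      simp
    have e2 : ∀ i, n + 1 ≤ i → u'.coeff i = 0 := by
      intro i hi
      rcases Nat.eq_or_lt_of_le hi with rfl | hi
      · simp only [hu', lin, sub_mul, Polynomial.coeff_add, Polynomial.coeff_sub,
          Polynomial.coeff_C_mul, mul_assoc, Polynomial.coeff_X_mul, Polynomial.coeff_X_pow]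
        rw [hpr]
        simp
      · rw [hu', Polynomial.coeff_add, Polynomial.coeff_add, hu _ hi,
          lin_mul_coeff (n + 1) _ _ _ (hX _) _ hi, lin_mul_coeff (n + 1) _ _ _ (hX _) _ hi]
        simp
    rw [Hm_succ _ _ _ _ _ (e2 _ le_rfl)] at e1
    obtain ⟨p, r, hp, hr, hu''⟩ := ih u' e2 ((mul_eq_zero.1 e1).resolve_left hα)
    refine ⟨p - Polynomial.C p0 * Polynomial.X ^ n, r - Polynomial.C r0 * Polynomial.X ^ n,
      ?_, ?_, ?_⟩
    · intro i hi
      rw [Polynomial.coeff_sub, hp _ (by omega), hX _ _ (by omega), sub_zero]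
    · intro i hi
      rw [Polynomial.coeff_sub, hr _ (by omega), hX _ _ (by omega), sub_zero]
    · rw [mul_sub, mul_sub, sub_add_sub_comm, ← hu'', hu']
      ring

lemma lin_relPrime [IsDomain R] {y1 y2 y3 y4 : R} (hrel : IsRelPrime y3 y1)
    (hq : y1 * y4 - y2 * y3 ≠ 0) : IsRelPrime (lin y3 y1) (lin y4 y2) := by
  intro d h1 h2
  have h3 : d ∣ Polynomial.C (y1 * y4 - y2 * y3) := by
    have : Polynomial.C (y1 * y4 - y2 * y3) =
        Polynomial.C y1 * lin y4 y2 - Polynomial.C y2 * lin y3 y1 := by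
      simp only [lin, map_mul, map_sub]; ring
    rw [this]
    exact dvd_sub (h2.mul_left _) (h1.mul_left _)
  have h4 := Polynomial.natDegree_le_of_dvd h3 (by simpa only [ne_eq, Polynomial.C_eq_zero] using hq)
  rw [Polynomial.natDegree_C, Nat.le_zero] at h4
  rw [Polynomial.eq_C_of_natDegree_eq_zero h4] at h1 ⊢
  rw [Polynomial.C_dvd_iff_dvd_coeff] at h1
  apply Polynomial.isUnit_C.2
  apply hrel
  · simpa [lin] using h1 0
  · simpa [lin, Polynomial.coeff_X] using h1 1

lemma lin_ne_zero {y z : R} (hy : y ≠ 0) : lin y z ≠ 0 := by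
  intro h
  apply hy
  simpa [lin] using congrArg (fun p => Polynomial.coeff p 0) h

lemma lin_mul_coeff_rev [IsDomain R] (n : ℕ) {y z : R} (hz : z ≠ 0) (w : Polynomial R)
    (hw : ∀ i, n + 1 ≤ i → (lin y z * w).coeff i = 0) : ∀ i, n ≤ i → w.coeff i = 0 := by
  by_cases hw0 : w = 0
  · simp [hw0]
  have hd : (lin y z).degree = 1 := by
    have : lin y z = Polynomial.C (-z) * Polynomial.X + Polynomial.C y := by
      unfold lin; simp; ring
    rw [this]
    exact Polynomial.degree_linear (neg_ne_zero.2 hz)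
  rw [← Polynomial.degree_lt_iff_coeff_zero] at hw ⊢
  rw [Polynomial.degree_mul, hd, Polynomial.degree_eq_natDegree hw0] at hw
  rw [Polynomial.degree_eq_natDegree hw0]
  norm_cast at hw ⊢
  omega

lemma koszul_two [IsDomain R] [UniqueFactorizationMonoid R] {y1 y2 y3 y4 : R}
    (hrel : IsRelPrime y3 y1) (h2 : y2 ≠ 0) (h4 : y4 ≠ 0)
    (hq : y1 * y4 - y2 * y3 ≠ 0) (n : ℕ) (p r : Polynomial R)
    (hp : ∀ i, n + 1 ≤ i → p.coeff i = 0)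
    (h0 : lin y3 y1 * p + lin y4 y2 * r = 0) :
    ∃ w : Polynomial R, (∀ i, n ≤ i → w.coeff i = 0) ∧
      p = lin y4 y2 * w ∧ r = - (lin y3 y1 * w) := by
  have hr := lin_relPrime hrel hq
  obtain ⟨w, hw⟩ : lin y4 y2 ∣ p := by
    apply hr.symm.dvd_of_dvd_mul_left
    exact ⟨-r, by linear_combination h0⟩
  refine ⟨w, ?_, hw, ?_⟩
  · apply lin_mul_coeff_rev n h2
    rwa [← hw]
  · apply mul_left_cancel₀ (lin_ne_zero (z := y2) h4)
    rw [hw] at h0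
    linear_combination h0
end Hm

section FG
variable {k : Type*} [Field k]

lemma X_relPrime {σ : Type*} {i j : σ} (hij : i ≠ j) :
    IsRelPrime (X i : MvPolynomial σ k) (X j) := by
  apply (X_prime (R := k)).irreducible.isRelPrime_iff_not_dvd.2
  rw [X_dvd_X]
  exact hij

lemma FG_relPrime (h : ℕ) : IsRelPrime
    (X 2 * X 3 ^ (h + 1) - X 1 * X 4 ^ (h + 1) : MvPolynomial (Fin 5) k)
    (X 0 * X 2 ^ h - X 1 ^ (h + 1) * X 3) := by
  apply IsRelPrime.of_map (finSuccEquiv k 4)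
  have e1 : finSuccEquiv k 4 (X 1) = Polynomial.C (X 0) := finSuccEquiv_X_succ (j := 0)
  have e2 : finSuccEquiv k 4 (X 2) = Polynomial.C (X 1) := finSuccEquiv_X_succ (j := 1)
  have e3 : finSuccEquiv k 4 (X 3) = Polynomial.C (X 2) := finSuccEquiv_X_succ (j := 2)
  have e4 : finSuccEquiv k 4 (X 4) = Polynomial.C (X 3) := finSuccEquiv_X_succ (j := 3)
  simp only [map_sub, map_mul, map_pow, e1, e2, e3, e4, finSuccEquiv_X_zero]
  intro d h1 h2
  have h3 : d ∣ Polynomial.C (X 1 * X 2 ^ (h + 1) - X 0 * X 3 ^ (h + 1) :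
      MvPolynomial (Fin 4) k) := by simpa using h1
  have hne : (X 1 * X 2 ^ (h + 1) - X 0 * X 3 ^ (h + 1) : MvPolynomial (Fin 4) k) ≠ 0 := by
    intro h0
    have := congrArg (aeval (![0, 1, 1, 1] : Fin 4 → k)) h0
    simp at this
  have h4 := Polynomial.natDegree_le_of_dvd h3 (by simpa only [ne_eq, Polynomial.C_eq_zero] using hne)
  rw [Polynomial.natDegree_C, Nat.le_zero] at h4
  rw [Polynomial.eq_C_of_natDegree_eq_zero h4] at h2 ⊢
  rw [Polynomial.C_dvd_iff_dvd_coeff] at h2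
  apply Polynomial.isUnit_C.2
  have hrel : IsRelPrime (X 1 ^ h : MvPolynomial (Fin 4) k) (X 0 ^ (h + 1) * X 2) := by
    apply IsRelPrime.mul_right
    · exact (X_relPrime (by decide)).pow
    · exact (X_relPrime (by decide)).pow_left
  have c1 := h2 1
  have c0 := h2 0
  simp only [← map_pow, ← map_mul, Polynomial.coeff_sub, Polynomial.coeff_C_zero,
    Polynomial.coeff_X_mul, Polynomial.coeff_C_succ, Polynomial.coeff_X_mul_zero, sub_zero,
    zero_sub, dvd_neg] at c1 c0
  apply hrel
  · simpa [Polynomial.coeff_C] using c1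
  · exact c0

/-- weights -/
def wt : Fin 5 → ℤ := ![0, 1, 1, -1, -1]

lemma whc_mul {φ : MvPolynomial (Fin 5) k} {a : ℤ} (hφ : IsWeightedHomogeneous wt φ a) (n : ℤ)
    (f : MvPolynomial (Fin 5) k) :
    weightedHomogeneousComponent wt (a + n) (φ * f) =
      φ * weightedHomogeneousComponent wt n f := by
  induction f using MvPolynomial.induction_on' with
  | monomial u c =>
    have hm : IsWeightedHomogeneous wt (monomial u c) (Finsupp.weight wt u) :=
      isWeightedHomogeneous_monomial wt u c rfl
    by_cases hu : Finsupp.weight wt u = n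
    · rw [hu] at hm
      rw [hm.weightedHomogeneousComponent_same, (hφ.mul hm).weightedHomogeneousComponent_same]
    · rw [hm.weightedHomogeneousComponent_ne _ (Ne.symm hu),
        (hφ.mul hm).weightedHomogeneousComponent_ne _ (by simpa using Ne.symm hu), mul_zero]
  | add p q hp hq => rw [mul_add, map_add, map_add, hp, hq, mul_add]

lemma whX (i : Fin 5) : IsWeightedHomogeneous wt (X i : MvPolynomial (Fin 5) k) (wt i) :=
  isWeightedHomogeneous_X _ _ _

lemma seg_wh (f : MvPolynomial (Fin 5) k) : IsWeightedHomogeneous wt (seg k f) 0 := by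
  induction f using MvPolynomial.induction_on with
  | C a => rw [show seg k (C a) = C a from (seg k).commutes a]; exact isWeightedHomogeneous_C _ _
  | add p q hp hq => rw [map_add]; exact hp.add hq
  | mul_X p i hp =>
    rw [map_mul]
    have : IsWeightedHomogeneous wt (seg k (X i)) 0 := by
      fin_cases i
      · simpa [wt] using whX (k := k) 0
      · simpa [wt] using (whX (k := k) 1).mul (whX 3)
      · simpa [wt] using (whX (k := k) 1).mul (whX 4)
      · simpa [wt] using (whX (k := k) 2).mul (whX 3)
      · simpa [wt] using (whX (k := k) 2).mul (whX 4)
    simpa using hp.mul this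

lemma Hm_wh (n : ℕ) (i j : Fin 5) (hij : wt i = wt j)
    (u : Polynomial (MvPolynomial (Fin 5) k)) :
    IsWeightedHomogeneous wt (Hm (seg k).toRingHom n (X i) (X j) u) (n • wt i) := by
  unfold Hm
  apply IsWeightedHomogeneous.sum
  intro l hl
  have h1 := ((seg_wh (u.coeff l)).mul ((whX (k := k) i).pow (n - l))).mul ((whX (k := k) j).pow l)
  rw [← hij, zero_add, ← add_smul, Nat.sub_add_cancel (by simp at hl; omega)] at h1
  exact h1

lemma wh_zero_mem (w : MvPolynomial (Fin 5) k) (hw : IsWeightedHomogeneous wt w 0) :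
    ∃ y, seg k y = w := by
  have key : w ∈ (seg k).range := by
    rw [w.as_sum]
    refine Subalgebra.sum_mem _ fun m hm => ?_
    have hwt := hw (mem_support_iff.1 hm)
    rw [show (monomial m (coeff m w) : MvPolynomial (Fin 5) k) = coeff m w • monomial m 1 by
      rw [smul_monomial]; simp]
    apply Subalgebra.smul_mem
    have e : m 1 + m 2 = m 3 + m 4 := by
      rw [Finsupp.weight_apply, Finsupp.sum_fintype _ _ (by simp)] at hwt
      simp [Fin.sum_univ_succ, wt] at hwt
      have e1 : Fin.succ (2 : Fin 4) = (3 : Fin 5) := rfl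
      have e2 : Fin.succ (3 : Fin 4) = (4 : Fin 5) := rfl
      try simp only [e1, e2] at hwt
      omega
    obtain ⟨z1, z2, z3, z4, a, b, c⟩ := exists_exp (m 1) (m 2) (m 4) (by omega)
    refine ⟨monomial (vec (m 0) z1 z2 z3 z4) 1, ?_⟩
    have : m 3 = z1 + z3 := by omega
    change seg k _ = _
    rw [seg_monomial, monomial_five, this, a, b, c]
    simp [vec]
  exact key

/-- The Koszul relation between `F` and `G` on the diagonal part. -/
lemma diag_koszul (h : ℕ) (u v : Polynomial (MvPolynomial (Fin 5) k))
    (h0 : (X 2 * X 3 ^ (h + 1) - X 1 * X 4 ^ (h + 1)) * Hm (seg k).toRingHom h (X 1) (X 2) u +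
      (X 0 * X 2 ^ h - X 1 ^ (h + 1) * X 3) * Hm (seg k).toRingHom h (X 4) (X 3) v = 0) :
    ∃ y, Hm (seg k).toRingHom h (X 1) (X 2) u =
        - ((X 0 * X 2 ^ h - X 1 ^ (h + 1) * X 3) * seg k y) ∧
      Hm (seg k).toRingHom h (X 4) (X 3) v =
        (X 2 * X 3 ^ (h + 1) - X 1 * X 4 ^ (h + 1)) * seg k y := by
  set F := (X 2 * X 3 ^ (h + 1) - X 1 * X 4 ^ (h + 1) : MvPolynomial (Fin 5) k) with hF
  set G := (X 0 * X 2 ^ h - X 1 ^ (h + 1) * X 3 : MvPolynomial (Fin 5) k) with hG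
  have hFne : F ≠ 0 := by
    intro h0
    have := congrArg (aeval (![1, 0, 1, 1, 1] : Fin 5 → k)) h0
    simp [hF] at this
  have hGwt : IsWeightedHomogeneous wt G (h : ℤ) := by
    apply IsWeightedHomogeneous.sub
    · simpa [wt] using (whX (k := k) 0).mul ((whX 2).pow h)
    · simpa [wt] using ((whX (k := k) 1).pow (h + 1)).mul (whX 3)
  obtain ⟨w, hw⟩ : G ∣ Hm (seg k).toRingHom h (X 1) (X 2) u := by
    apply (FG_relPrime h).symm.dvd_of_dvd_mul_left
    exact ⟨-Hm (seg k).toRingHom h (X 4) (X 3) v, by linear_combination h0⟩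
  obtain ⟨y, hy⟩ := wh_zero_mem _ (weightedHomogeneousComponent_isWeightedHomogeneous (w := wt) 0 (-w))
  have e1 : Hm (seg k).toRingHom h (X 1) (X 2) u = - (G * seg k y) := by
    have h1 := Hm_wh (k := k) h 1 2 (by simp [wt]) u
    have h2 : (h • wt 1 : ℤ) = h + 0 := by simp [wt]
    rw [h2] at h1
    have h3 := h1.weightedHomogeneousComponent_same
    rw [hw, whc_mul hGwt] at h3
    rw [hw, hy, map_neg, mul_neg, neg_neg, h3]
  refine ⟨y, e1, ?_⟩
  have hGne : G ≠ 0 := by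
    intro h0
    have := congrArg (aeval (![1, 0, 1, 1, 1] : Fin 5 → k)) h0
    simp [hG] at this
  apply mul_left_cancel₀ hGne
  rw [e1] at h0
  linear_combination h0

end FG
end Arslan

namespace Arslan

section more
variable {R P S : Type*} [CommRing R] [CommRing P] [CommRing S] (π : R →+* P)

lemma Hm_map (σ : P →+* S) (n : ℕ) (α β : P) (u : Polynomial R) :
    σ (Hm π n α β u) = Hm (σ.comp π) n (σ α) (σ β) u := by
  simp [Hm, map_sum]

lemma Hm_scale (n : ℕ) (c α β : P) (u : Polynomial R) :
    Hm π n (c * α) (c * β) u = c ^ n * Hm π n α β u := by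
  unfold Hm
  rw [Finset.mul_sum]
  refine Finset.sum_congr rfl fun i hi => ?_
  have : c ^ n = c ^ (n - i) * c ^ i := by
    rw [← pow_add, Nat.sub_add_cancel (by simp at hi; omega)]
  rw [this, mul_pow, mul_pow]
  ring

lemma Hm_scale' (n : ℕ) (c α β : P) (u : Polynomial R) :
    Hm π n (α * c) (β * c) u = c ^ n * Hm π n α β u := by
  rw [mul_comm α, mul_comm β, Hm_scale]

/-- binomial `y T^n - z` -/
noncomputable def bin (n : ℕ) (y z : R) : Polynomial R :=
  Polynomial.C y * Polynomial.X ^ n - Polynomial.C z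

lemma bin_coeff (n : ℕ) (y z : R) (i : ℕ) (hi : n + 1 ≤ i) : (bin n y z).coeff i = 0 := by
  rw [bin, Polynomial.coeff_sub, Polynomial.coeff_C_mul_X_pow, Polynomial.coeff_C,
    if_neg (by omega), if_neg (by omega), sub_zero]

lemma bin_mem (m : Ideal R) (n : ℕ) (y z : R) (hy : y ∈ m) (hz : z ∈ m) (i : ℕ) :
    (bin n y z).coeff i ∈ m := by
  rw [bin, Polynomial.coeff_sub, Polynomial.coeff_C_mul_X_pow, Polynomial.coeff_C]
  apply m.sub_mem
  · split_ifs <;> simp [hy]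
  · split_ifs <;> simp [hz]

lemma Hm_bin (n : ℕ) (α β : P) (y z : R) :
    Hm π n α β (bin n y z) = π y * β ^ n - π z * α ^ n := by
  have : bin n y z = Polynomial.C y * Polynomial.X ^ n - Polynomial.C z * Polynomial.X ^ 0 := by
    simp [bin]
  rw [this, Hm_sub, Hm_C_mul, Hm_C_mul, Hm_X_pow _ _ _ _ _ le_rfl, Hm_X_pow _ _ _ _ _ (Nat.zero_le n)]
  simp

end more

section
variable {k : Type*} [Field k]

local notation "RR" => MvPolynomial (Fin 5) k
local notation "HH" => Hm (RingHom.id (MvPolynomial (Fin 5) k))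

/-- F part -/
noncomputable def PhiF (h : ℕ) (u : Polynomial RR) : RR :=
  X 3 * HH h (X 1) (X 3) u - X 2 * HH h (X 2) (X 4) u

/-- G part -/
noncomputable def PhiG (h : ℕ) (v : Polynomial RR) : RR :=
  X 0 * HH h (X 4) (X 3) v - X 1 * HH h (X 2) (X 1) v

/-- gen -/
noncomputable def gg (h : ℕ) : Polynomial RR := bin h (X 0) (X 1)
/-- gen -/
noncomputable def ff (h : ℕ) : Polynomial RR := bin h (X 3) (X 2)

/-- first component of the second differential -/
noncomputable def Phi2 (n : ℕ) (p r p' r' : Polynomial RR) : RR :=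
  - (X 3 * HH n (X 1) (X 3) r + X 2 * HH n (X 2) (X 4) p + X 0 * HH n (X 4) (X 3) p' +
    X 1 * HH n (X 2) (X 1) r')

/-- second component -/
noncomputable def PhiA (h : ℕ) (y : RR) (p r : Polynomial RR) : Polynomial RR :=
  - (Polynomial.C y * gg h) + (lin (X 3) (X 1) * p + lin (X 4) (X 2) * r)

/-- third component -/
noncomputable def PhiC (h : ℕ) (y : RR) (p r : Polynomial RR) : Polynomial RR :=
  Polynomial.C y * ff h + (lin (X 1) (X 2) * p + lin (X 3) (X 4) * r)

lemma PhiF_A (n : ℕ) (y : RR) (p r : Polynomial RR) (hp : p.coeff (n + 1) = 0)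
    (hr : r.coeff (n + 1) = 0) :
    PhiF (n + 1) (PhiA (n + 1) y p r) = - (y * PhiF (n + 1) (gg (n + 1))) +
      Q k * (X 3 * HH n (X 1) (X 3) r + X 2 * HH n (X 2) (X 4) p) := by
  have e : PhiA (n + 1) y p r = lin (X 3) (X 1) * p + lin (X 4) (X 2) * r -
    Polynomial.C y * gg (n + 1) := by unfold PhiA; ring
  rw [e]
  simp only [PhiF, Hm_add, Hm_sub, Hm_C_mul, Hm_lin _ _ _ _ _ _ _ hp, Hm_lin _ _ _ _ _ _ _ hr, Q,
    RingHom.id_apply]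
  ring

lemma PhiG_C (n : ℕ) (y : RR) (p r : Polynomial RR) (hp : p.coeff (n + 1) = 0)
    (hr : r.coeff (n + 1) = 0) :
    PhiG (n + 1) (PhiC (n + 1) y p r) = y * PhiG (n + 1) (ff (n + 1)) +
      Q k * (X 0 * HH n (X 4) (X 3) p + X 1 * HH n (X 2) (X 1) r) := by
  unfold PhiC
  simp only [PhiG, Hm_add, Hm_C_mul, Hm_lin _ _ _ _ _ _ _ hp, Hm_lin _ _ _ _ _ _ _ hr, Q,
    RingHom.id_apply]
  ring

lemma PhiF_gg (h : ℕ) : PhiF h (gg h : Polynomial RR) = PhiG h (ff h) := by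
  simp only [PhiF, PhiG, gg, ff, Hm_bin, RingHom.id_apply]
  ring

lemma comp_zero (n : ℕ) (y : RR) (p r p' r' : Polynomial RR) (hp : p.coeff (n + 1) = 0)
    (hr : r.coeff (n + 1) = 0) (hp' : p'.coeff (n + 1) = 0) (hr' : r'.coeff (n + 1) = 0) :
    Phi2 n p r p' r' * Q k + PhiF (n + 1) (PhiA (n + 1) y p r) +
      PhiG (n + 1) (PhiC (n + 1) y p' r') = 0 := by
  rw [PhiF_A n y p r hp hr, PhiG_C n y p' r' hp' hr', PhiF_gg]
  unfold Phi2
  ring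

/-- images under a homomorphism factoring through the quadric cone -/
lemma map_PhiF {P : Type*} [CommRing P] (π : RR →+* P) {a b c d : P} (h1 : π (X 1) = a * c)
    (h2 : π (X 2) = a * d) (h3 : π (X 3) = b * c) (h4 : π (X 4) = b * d) (h : ℕ)
    (u : Polynomial RR) :
    π (PhiF h u) = (b * c ^ (h + 1) - a * d ^ (h + 1)) * Hm π h a b u := by
  unfold PhiF
  rw [map_sub, map_mul, map_mul, Hm_map, Hm_map, h1, h2, h3, h4, Hm_scale', Hm_scale',
    RingHom.comp_id]
  ring

lemma map_PhiG {P : Type*} [CommRing P] (π : RR →+* P) {a b c d : P} (h1 : π (X 1) = a * c)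
    (h2 : π (X 2) = a * d) (h3 : π (X 3) = b * c) (h4 : π (X 4) = b * d) (h : ℕ)
    (u : Polynomial RR) :
    π (PhiG h u) = (π (X 0) * b ^ h - a ^ (h + 1) * c) * Hm π h d c u := by
  unfold PhiG
  rw [map_sub, map_mul, map_mul, Hm_map, Hm_map, h1, h2, h3, h4, Hm_scale, Hm_scale,
    RingHom.comp_id]
  ring

lemma Q_ne : Q k ≠ 0 := by
  intro h0
  have := congrArg (aeval (![1, 1, 0, 1, 1] : Fin 5 → k)) h0
  simp [Q] at this

lemma kosA (n : ℕ) (u : Polynomial RR) (hu : ∀ i, n + 2 ≤ i → u.coeff i = 0)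
    (h0 : Hm (seg k).toRingHom (n + 1) (X 1) (X 2) u = 0) :
    ∃ p r : Polynomial RR, (∀ i, n + 1 ≤ i → p.coeff i = 0) ∧
      (∀ i, n + 1 ≤ i → r.coeff i = 0) ∧ u = lin (X 3) (X 1) * p + lin (X 4) (X 2) * r := by
  have := koszul_one (π := (seg k).toRingHom) (y1 := X 1) (y2 := X 2) (y3 := X 3) (y4 := X 4)
    (α := X 1) (β := X 2) (X_ne_zero _) (by simp; ring) (by simp; ring)
    (fun f hf => seg_ker f hf) (fun n f hf => dvd_a n f hf) (n + 1) u hu h0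
  simpa using this

lemma kosC (n : ℕ) (u : Polynomial RR) (hu : ∀ i, n + 2 ≤ i → u.coeff i = 0)
    (h0 : Hm (seg k).toRingHom (n + 1) (X 4) (X 3) u = 0) :
    ∃ p r : Polynomial RR, (∀ i, n + 1 ≤ i → p.coeff i = 0) ∧
      (∀ i, n + 1 ≤ i → r.coeff i = 0) ∧ u = lin (X 1) (X 2) * p + lin (X 3) (X 4) * r := by
  have := koszul_one (π := (seg k).toRingHom) (y1 := X 2) (y2 := X 4) (y3 := X 1) (y4 := X 3)
    (α := X 4) (β := X 3) (X_ne_zero _) (by simp; ring) (by simp; ring)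
    (fun f hf => by
      obtain ⟨y, hy⟩ := seg_ker f hf
      exact ⟨-y, by rw [hy, Q]; ring⟩) (fun n f hf => dvd_d n f hf) (n + 1) u hu h0
  simpa using this

/-- exactness at the first syzygies -/
lemma exact_one (n : ℕ) (r0 : RR) (u v : Polynomial RR) (hu : ∀ i, n + 2 ≤ i → u.coeff i = 0)
    (hv : ∀ i, n + 2 ≤ i → v.coeff i = 0)
    (h0 : r0 * Q k + PhiF (n + 1) u + PhiG (n + 1) v = 0) :
    ∃ (y : RR) (p r p' r' : Polynomial RR), (∀ i, n + 1 ≤ i → p.coeff i = 0) ∧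
      (∀ i, n + 1 ≤ i → r.coeff i = 0) ∧ (∀ i, n + 1 ≤ i → p'.coeff i = 0) ∧
      (∀ i, n + 1 ≤ i → r'.coeff i = 0) ∧ r0 = Phi2 n p r p' r' ∧
      u = PhiA (n + 1) y p r ∧ v = PhiC (n + 1) y p' r' := by
  have hs := congrArg (seg k).toRingHom h0
  rw [map_add, map_add, map_zero, map_mul, show (seg k).toRingHom (Q k) = 0 from seg_Q, mul_zero,
    zero_add,
    map_PhiF (seg k).toRingHom (a := X 1) (b := X 2) (c := X 3) (d := X 4)
      seg1 seg2 seg3 seg4,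
    map_PhiG (seg k).toRingHom (a := X 1) (b := X 2) (c := X 3) (d := X 4)
      seg1 seg2 seg3 seg4, show (seg k).toRingHom (X 0) = X 0 from seg0] at hs
  obtain ⟨y, hy1, hy2⟩ := diag_koszul _ _ _ hs
  obtain ⟨p, r, hp, hr, e1⟩ := kosA n (u + Polynomial.C y * gg (n + 1))
    (by intro i hi; rw [Polynomial.coeff_add, hu i hi, Polynomial.coeff_C_mul, gg,
          bin_coeff _ _ _ i hi]; simp)
    (by rw [Hm_add, Hm_C_mul, hy1, gg, Hm_bin]
        simp only [AlgHom.toRingHom_eq_coe, RingHom.coe_coe, seg0, seg1]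
        ring)
  obtain ⟨p', r', hp', hr', e2⟩ := kosC n (v - Polynomial.C y * ff (n + 1))
    (by intro i hi; rw [Polynomial.coeff_sub, hv i hi, Polynomial.coeff_C_mul, ff,
          bin_coeff _ _ _ i hi]; simp)
    (by rw [Hm_sub, Hm_C_mul, hy2, ff, Hm_bin]
        simp only [AlgHom.toRingHom_eq_coe, RingHom.coe_coe, seg2, seg3]
        ring)
  have eu : u = PhiA (n + 1) y p r := by unfold PhiA; linear_combination e1
  have ev : v = PhiC (n + 1) y p' r' := by unfold PhiC; linear_combination e2
  refine ⟨y, p, r, p', r', hp, hr, hp', hr', ?_, eu, ev⟩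
  have := comp_zero n y p r p' r' (hp _ le_rfl) (hr _ le_rfl) (hp' _ le_rfl) (hr' _ le_rfl)
  rw [← eu, ← ev] at this
  apply mul_right_cancel₀ (Q_ne (k := k))
  linear_combination h0 - this

/-- components of the third differential; here the ambient `h = n + 1`. -/
noncomputable def Ap (n : ℕ) (z : RR) (w : Polynomial RR) : Polynomial RR :=
  - (Polynomial.C z * bin n (X 0 * X 4) (X 1 * X 2)) + lin (X 4) (X 2) * w
/-- component -/
noncomputable def Ar (n : ℕ) (z : RR) (w : Polynomial RR) : Polynomial RR :=
  Polynomial.C z * bin n (X 0 * X 3) (X 1 * X 1) - lin (X 3) (X 1) * w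
/-- component -/
noncomputable def Cp (n : ℕ) (z : RR) (w : Polynomial RR) : Polynomial RR :=
  - (Polynomial.C z * bin n (X 3 * X 3) (X 2 * X 4)) + lin (X 3) (X 4) * w
/-- component -/
noncomputable def Cr (n : ℕ) (z : RR) (w : Polynomial RR) : Polynomial RR :=
  Polynomial.C z * bin n (X 3 * X 1) (X 2 * X 2) - lin (X 1) (X 2) * w

lemma PhiA_zero (n : ℕ) (z : RR) (w : Polynomial RR) :
    PhiA (n + 1) (z * Q k) (Ap n z w) (Ar n z w) = 0 := by
  simp only [PhiA, gg, Ap, Ar, bin, lin, Q, map_mul, map_sub]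
  ring

lemma PhiC_zero (n : ℕ) (z : RR) (w : Polynomial RR) :
    PhiC (n + 1) (z * Q k) (Cp n z w) (Cr n z w) = 0 := by
  simp only [PhiC, ff, Cp, Cr, bin, lin, Q, map_mul, map_sub]
  ring

lemma comb_coeff (n : ℕ) (z : RR) (w : Polynomial RR) (hw : ∀ i, n ≤ i → w.coeff i = 0)
    (a b c d : RR) (i : ℕ) (hi : n + 1 ≤ i) :
    (Polynomial.C z * bin n a b - lin c d * w).coeff i = 0 := by
  rw [Polynomial.coeff_sub, Polynomial.coeff_C_mul, bin_coeff _ _ _ i hi,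
    lin_mul_coeff n _ _ _ hw i hi]
  simp

lemma comb_coeff' (n : ℕ) (z : RR) (w : Polynomial RR) (hw : ∀ i, n ≤ i → w.coeff i = 0)
    (a b c d : RR) (i : ℕ) (hi : n + 1 ≤ i) :
    (-(Polynomial.C z * bin n a b) + lin c d * w).coeff i = 0 := by
  rw [Polynomial.coeff_add, Polynomial.coeff_neg, Polynomial.coeff_C_mul, bin_coeff _ _ _ i hi,
    lin_mul_coeff n _ _ _ hw i hi]
  simp

lemma Phi2_zero (n : ℕ) (z : RR) (w w' : Polynomial RR) (hw : ∀ i, n ≤ i → w.coeff i = 0)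
    (hw' : ∀ i, n ≤ i → w'.coeff i = 0) :
    Phi2 n (Ap n z w) (Ar n z w) (Cp n z w') (Cr n z w') = 0 := by
  have := comp_zero n (z * Q k) (Ap n z w) (Ar n z w) (Cp n z w') (Cr n z w')
    (comb_coeff' n z w hw _ _ _ _ _ le_rfl) (comb_coeff n z w hw _ _ _ _ _ le_rfl)
    (comb_coeff' n z w' hw' _ _ _ _ _ le_rfl) (comb_coeff n z w' hw' _ _ _ _ _ le_rfl)
  rw [PhiA_zero, PhiC_zero] at this
  have h1 : PhiF (n + 1) (0 : Polynomial RR) = 0 := by simp [PhiF, Hm]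
  have h2 : PhiG (n + 1) (0 : Polynomial RR) = 0 := by simp [PhiG, Hm]
  rw [h1, h2, add_zero, add_zero] at this
  exact (mul_eq_zero.1 this).resolve_right Q_ne

lemma exact_two (n : ℕ) (y : RR) (p r p' r' : Polynomial RR)
    (hp : ∀ i, n + 1 ≤ i → p.coeff i = 0) (hr : ∀ i, n + 1 ≤ i → r.coeff i = 0)
    (hp' : ∀ i, n + 1 ≤ i → p'.coeff i = 0)
    (hA : PhiA (n + 1) y p r = 0) (hC : PhiC (n + 1) y p' r' = 0) :
    ∃ (z : RR) (w w' : Polynomial RR), (∀ i, n ≤ i → w.coeff i = 0) ∧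
      (∀ i, n ≤ i → w'.coeff i = 0) ∧ y = z * Q k ∧ p = Ap n z w ∧ r = Ar n z w ∧
      p' = Cp n z w' ∧ r' = Cr n z w' := by
  have hz : seg k y = 0 := by
    have e : lin (X 3) (X 1) * p + lin (X 4) (X 2) * r - Polynomial.C y * gg (n + 1) = 0 := by
      rw [← hA]; unfold PhiA; ring
    have e2 := congrArg (Hm (seg k).toRingHom (n + 1) (X 1) (X 2)) e
    rw [Hm_sub, Hm_add, Hm_lin _ _ _ _ _ _ _ (hp _ le_rfl), Hm_lin _ _ _ _ _ _ _ (hr _ le_rfl),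
      Hm_C_mul, gg, Hm_bin] at e2
    simp only [AlgHom.toRingHom_eq_coe, RingHom.coe_coe, seg0, seg1, seg2, seg3, seg4] at e2
    have e3 : seg k y * (X 0 * X 2 ^ (n + 1) - X 1 * X 3 * X 1 ^ (n + 1)) = 0 := by
      have h00 : Hm (seg k : RR →+* RR) (n + 1) (X 1) (X 2) 0 = 0 := by simp [Hm]
      rw [h00] at e2
      linear_combination -e2
    refine (mul_eq_zero.1 e3).resolve_right ?_
    intro h0
    have := congrArg (aeval (![1, 0, 1, 1, 1] : Fin 5 → k)) h0
    simp at this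
  obtain ⟨z, rfl⟩ := seg_ker y hz
  have zA := PhiA_zero n z (0 : Polynomial RR)
  have zC := PhiC_zero n z (0 : Polynomial RR)
  have c0 : ∀ i, n ≤ i → (0 : Polynomial RR).coeff i = 0 := by simp
  obtain ⟨w, hw, e1, e2⟩ := koszul_two (y1 := (X 1 : RR)) (y2 := X 2) (y3 := X 3) (y4 := X 4)
    (X_relPrime (by decide)) (X_ne_zero _) (X_ne_zero _) (Q_ne (k := k)) n
    (p - Ap n z 0) (r - Ar n z 0)
    (by intro i hi
        rw [Polynomial.coeff_sub, hp i hi, Ap, comb_coeff' n z 0 c0 _ _ _ _ i hi, sub_zero])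
    (by unfold PhiA at hA zA; linear_combination hA - zA)
  obtain ⟨w', hw', e1', e2'⟩ := koszul_two (y1 := (X 2 : RR)) (y2 := X 4) (y3 := X 1) (y4 := X 3)
    (X_relPrime (by decide)) (X_ne_zero _) (X_ne_zero _)
    (by intro h0; apply Q_ne (k := k); unfold Q; linear_combination -h0) n
    (p' - Cp n z 0) (r' - Cr n z 0)
    (by intro i hi
        rw [Polynomial.coeff_sub, hp' i hi, Cp, comb_coeff' n z 0 c0 _ _ _ _ i hi, sub_zero])
    (by unfold PhiC at hC zC; linear_combination hC - zC)
  refine ⟨z, w, w', hw, hw', rfl, ?_, ?_, ?_, ?_⟩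
  · unfold Ap at *; linear_combination e1
  · unfold Ar at *; linear_combination e2
  · unfold Cp at *; linear_combination e1'
  · unfold Cr at *; linear_combination e2'

end
end Arslan

namespace Arslan

section smul
variable {R M N : Type*} [CommRing R] [AddCommGroup M] [Module R M] [AddCommGroup N] [Module R N]

lemma mem_smul_prod (m : Ideal R) {a : M} {b : N} (ha : a ∈ m • (⊤ : Submodule R M))
    (hb : b ∈ m • (⊤ : Submodule R N)) : (a, b) ∈ m • (⊤ : Submodule R (M × N)) := by
  have h1 : (LinearMap.inl R M N) a ∈ m • (⊤ : Submodule R (M × N)) := by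
    have : (LinearMap.inl R M N) a ∈ Submodule.map (LinearMap.inl R M N) (m • ⊤) :=
      Submodule.mem_map_of_mem ha
    rw [Submodule.map_smul''] at this
    exact Submodule.smul_mono le_rfl le_top this
  have h2 : (LinearMap.inr R M N) b ∈ m • (⊤ : Submodule R (M × N)) := by
    have : (LinearMap.inr R M N) b ∈ Submodule.map (LinearMap.inr R M N) (m • ⊤) :=
      Submodule.mem_map_of_mem hb
    rw [Submodule.map_smul''] at this
    exact Submodule.smul_mono le_rfl le_top this
  have := add_mem h1 h2
  simpa using this

lemma mem_smul_ring (m : Ideal R) {a : R} (ha : a ∈ m) : a ∈ m • (⊤ : Submodule R R) := by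
  have := Submodule.smul_mem_smul ha (Submodule.mem_top (x := (1 : R)) (R := R))
  simpa using this

lemma mem_smul_equiv (m : Ideal R) (e : M ≃ₗ[R] N) {a : M} (ha : a ∈ m • (⊤ : Submodule R M)) :
    e a ∈ m • (⊤ : Submodule R N) := by
  have : (e : M →ₗ[R] N) a ∈ Submodule.map (e : M →ₗ[R] N) (m • ⊤) := Submodule.mem_map_of_mem ha
  rw [Submodule.map_smul''] at this
  exact Submodule.smul_mono le_rfl le_top this

lemma mem_smul_pi (m : Ideal R) {n : ℕ} (v : Fin n → R) (hv : ∀ i, v i ∈ m) :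
    v ∈ m • (⊤ : Submodule R (Fin n → R)) := by
  rw [pi_eq_sum_univ' v]
  exact Submodule.sum_mem _ fun i _ => Submodule.smul_mem_smul (hv i) Submodule.mem_top

lemma mem_smul_degreeLT (m : Ideal R) {n : ℕ} (p : Polynomial.degreeLT R n)
    (hp : ∀ i, (p : Polynomial R).coeff i ∈ m) : p ∈ m • (⊤ : Submodule R (Polynomial.degreeLT R n)) := by
  have := mem_smul_equiv m (Polynomial.degreeLTEquiv R n).symm
    (mem_smul_pi m (Polynomial.degreeLTEquiv R n p) (fun i => hp i))
  simpa using this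

lemma mem_smul_triple (m : Ideal R) (a b : ℕ)
    (x : R × Polynomial.degreeLT R a × Polynomial.degreeLT R b) (h1 : x.1 ∈ m)
    (h2 : ∀ i, (x.2.1 : Polynomial R).coeff i ∈ m) (h3 : ∀ i, (x.2.2 : Polynomial R).coeff i ∈ m) :
    x ∈ m • (⊤ : Submodule R (R × Polynomial.degreeLT R a × Polynomial.degreeLT R b)) :=
  mem_smul_prod m (mem_smul_ring m h1) (mem_smul_prod m (mem_smul_degreeLT m _ h2)
    (mem_smul_degreeLT m _ h3))

lemma mem_smul_five (m : Ideal R) (a : ℕ)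
    (x : R × (Polynomial.degreeLT R a × Polynomial.degreeLT R a) ×
      (Polynomial.degreeLT R a × Polynomial.degreeLT R a)) (h1 : x.1 ∈ m)
    (h2 : ∀ i, (x.2.1.1 : Polynomial R).coeff i ∈ m)
    (h3 : ∀ i, (x.2.1.2 : Polynomial R).coeff i ∈ m)
    (h4 : ∀ i, (x.2.2.1 : Polynomial R).coeff i ∈ m)
    (h5 : ∀ i, (x.2.2.2 : Polynomial R).coeff i ∈ m) :
    x ∈ m • (⊤ : Submodule R (R × (Polynomial.degreeLT R a × Polynomial.degreeLT R a) ×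
      (Polynomial.degreeLT R a × Polynomial.degreeLT R a))) :=
  mem_smul_prod m (mem_smul_ring m h1) (mem_smul_prod m
    (mem_smul_prod m (mem_smul_degreeLT m _ h2) (mem_smul_degreeLT m _ h3))
    (mem_smul_prod m (mem_smul_degreeLT m _ h4) (mem_smul_degreeLT m _ h5)))

lemma mem_dlt {n : ℕ} {p : Polynomial R} :
    p ∈ Polynomial.degreeLT R n ↔ ∀ i, n ≤ i → p.coeff i = 0 := by
  rw [Polynomial.mem_degreeLT, Polynomial.degree_lt_iff_coeff_zero]

lemma exists_equiv [Nontrivial R] (a b N : ℕ) (hN : N = 1 + (a + b)) :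
    Nonempty ((R × Polynomial.degreeLT R a × Polynomial.degreeLT R b) ≃ₗ[R] (Fin N → R)) := by
  refine ⟨(LinearEquiv.prodCongr (LinearEquiv.refl R R) (LinearEquiv.prodCongr
    (Polynomial.degreeLTEquiv R a) (Polynomial.degreeLTEquiv R b))).trans
    (LinearEquiv.ofFinrankEq _ _ ?_)⟩
  simp [hN]

lemma exists_equiv4 [Nontrivial R] (a N : ℕ) (hN : N = 1 + ((a + a) + (a + a))) :
    Nonempty ((R × (Polynomial.degreeLT R a × Polynomial.degreeLT R a) ×
      (Polynomial.degreeLT R a × Polynomial.degreeLT R a)) ≃ₗ[R] (Fin N → R)) := by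
  refine ⟨(LinearEquiv.prodCongr (LinearEquiv.refl R R) (LinearEquiv.prodCongr
    (LinearEquiv.prodCongr (Polynomial.degreeLTEquiv R a) (Polynomial.degreeLTEquiv R a))
    (LinearEquiv.prodCongr (Polynomial.degreeLTEquiv R a) (Polynomial.degreeLTEquiv R a)))).trans
    (LinearEquiv.ofFinrankEq _ _ ?_)⟩
  simp [hN]

lemma Hm_neg {P : Type*} [CommRing P] (π : R →+* P) (n : ℕ) (α β : P) (u : Polynomial R) :
    Hm π n α β (-u) = - Hm π n α β u := by
  simp [Hm]

lemma Hm_smul {P : Type*} [CommRing P] (π : R →+* P) (n : ℕ) (α β : P) (c : R) (u : Polynomial R) :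
    Hm π n α β (c • u) = π c * Hm π n α β u := by
  rw [Polynomial.smul_eq_C_mul, Hm_C_mul]

end smul

section
variable {k : Type*} [Field k]

local notation "RR" => MvPolynomial (Fin 5) k
local notation "DD" => Polynomial.degreeLT (MvPolynomial (Fin 5) k)

/-- first differential -/
noncomputable def f1 (h : ℕ) : (RR × DD (h + 1) × DD (h + 1)) →ₗ[RR] RR where
  toFun c := c.1 * Q k + PhiF h c.2.1 + PhiG h c.2.2
  map_add' c c' := by
    simp only [PhiF, PhiG, Prod.fst_add, Prod.snd_add, Submodule.coe_add, Hm_add]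
    ring
  map_smul' a c := by
    simp only [PhiF, PhiG, Prod.smul_fst, Prod.smul_snd, Submodule.coe_smul, Hm_smul, smul_eq_mul,
      RingHom.id_apply]
    ring

lemma PhiA_coeff (n : ℕ) (y : RR) (p r : Polynomial RR) (hp : ∀ i, n + 1 ≤ i → p.coeff i = 0)
    (hr : ∀ i, n + 1 ≤ i → r.coeff i = 0) (i : ℕ) (hi : n + 2 ≤ i) :
    (PhiA (n + 1) y p r).coeff i = 0 := by
  rw [PhiA, Polynomial.coeff_add, Polynomial.coeff_neg, Polynomial.coeff_C_mul, gg,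
    bin_coeff _ _ _ i hi, Polynomial.coeff_add, lin_mul_coeff _ _ _ _ hp i hi,
    lin_mul_coeff _ _ _ _ hr i hi]
  simp

lemma PhiC_coeff (n : ℕ) (y : RR) (p r : Polynomial RR) (hp : ∀ i, n + 1 ≤ i → p.coeff i = 0)
    (hr : ∀ i, n + 1 ≤ i → r.coeff i = 0) (i : ℕ) (hi : n + 2 ≤ i) :
    (PhiC (n + 1) y p r).coeff i = 0 := by
  rw [PhiC, Polynomial.coeff_add, Polynomial.coeff_C_mul, ff,
    bin_coeff _ _ _ i hi, Polynomial.coeff_add, lin_mul_coeff _ _ _ _ hp i hi,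
    lin_mul_coeff _ _ _ _ hr i hi]
  simp

/-- second differential -/
noncomputable def f2 (n : ℕ) : (RR × (DD (n + 1) × DD (n + 1)) × (DD (n + 1) × DD (n + 1))) →ₗ[RR]
    (RR × DD (n + 2) × DD (n + 2)) where
  toFun c := (Phi2 n c.2.1.1 c.2.1.2 c.2.2.1 c.2.2.2,
    ⟨PhiA (n + 1) c.1 c.2.1.1 c.2.1.2, mem_dlt.2 (PhiA_coeff n _ _ _ (mem_dlt.1 c.2.1.1.2)
      (mem_dlt.1 c.2.1.2.2))⟩,
    ⟨PhiC (n + 1) c.1 c.2.2.1 c.2.2.2, mem_dlt.2 (PhiC_coeff n _ _ _ (mem_dlt.1 c.2.2.1.2)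
      (mem_dlt.1 c.2.2.2.2))⟩)
  map_add' c c' := by
    refine Prod.ext ?_ (Prod.ext (Subtype.ext ?_) (Subtype.ext ?_))
    · simp only [Phi2, Prod.fst_add, Prod.snd_add, Submodule.coe_add, Hm_add]
      ring
    · simp only [PhiA, Prod.fst_add, Prod.snd_add, Submodule.coe_add, map_add]
      ring
    · simp only [PhiC, Prod.fst_add, Prod.snd_add, Submodule.coe_add, map_add]
      ring
  map_smul' a c := by
    refine Prod.ext ?_ (Prod.ext (Subtype.ext ?_) (Subtype.ext ?_))
    · simp only [Phi2, Prod.smul_fst, Prod.smul_snd, Submodule.coe_smul, Hm_smul, smul_eq_mul,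
        RingHom.id_apply]
      ring
    · simp only [PhiA, Prod.smul_fst, Prod.smul_snd, Submodule.coe_smul, smul_eq_mul,
        RingHom.id_apply, Polynomial.smul_eq_C_mul, map_mul]
      ring
    · simp only [PhiC, Prod.smul_fst, Prod.smul_snd, Submodule.coe_smul, smul_eq_mul,
        RingHom.id_apply, Polynomial.smul_eq_C_mul, map_mul]
      ring

/-- third differential -/
noncomputable def f3 (n : ℕ) : (RR × DD n × DD n) →ₗ[RR]
    (RR × (DD (n + 1) × DD (n + 1)) × (DD (n + 1) × DD (n + 1))) where
  toFun c := (c.1 * Q k,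
    (⟨Ap n c.1 c.2.1, mem_dlt.2 (comb_coeff' n _ _ (mem_dlt.1 c.2.1.2) _ _ _ _)⟩,
     ⟨Ar n c.1 c.2.1, mem_dlt.2 (comb_coeff n _ _ (mem_dlt.1 c.2.1.2) _ _ _ _)⟩),
    (⟨Cp n c.1 c.2.2, mem_dlt.2 (comb_coeff' n _ _ (mem_dlt.1 c.2.2.2) _ _ _ _)⟩,
     ⟨Cr n c.1 c.2.2, mem_dlt.2 (comb_coeff n _ _ (mem_dlt.1 c.2.2.2) _ _ _ _)⟩))
  map_add' c c' := by
    refine Prod.ext ?_ (Prod.ext (Prod.ext (Subtype.ext ?_) (Subtype.ext ?_))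
      (Prod.ext (Subtype.ext ?_) (Subtype.ext ?_)))
    all_goals
      simp only [Ap, Ar, Cp, Cr, Prod.fst_add, Prod.snd_add, Submodule.coe_add, map_add]
      ring
  map_smul' a c := by
    refine Prod.ext ?_ (Prod.ext (Prod.ext (Subtype.ext ?_) (Subtype.ext ?_))
      (Prod.ext (Subtype.ext ?_) (Subtype.ext ?_)))
    all_goals
      simp only [Ap, Ar, Cp, Cr, Prod.smul_fst, Prod.smul_snd, Submodule.coe_smul, smul_eq_mul,
        RingHom.id_apply, Polynomial.smul_eq_C_mul, map_mul]
      ring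

lemma f_exact1 (n : ℕ) : LinearMap.range (f2 (k := k) n) = LinearMap.ker (f1 (n + 1)) := by
  apply le_antisymm
  · rintro _ ⟨c, rfl⟩
    exact comp_zero n c.1 _ _ _ _ (mem_dlt.1 c.2.1.1.2 _ le_rfl) (mem_dlt.1 c.2.1.2.2 _ le_rfl)
      (mem_dlt.1 c.2.2.1.2 _ le_rfl) (mem_dlt.1 c.2.2.2.2 _ le_rfl)
  · rintro ⟨r0, ⟨u, hu⟩, ⟨v, hv⟩⟩ hc
    obtain ⟨y, p, r, p', r', hp, hr, hp', hr', e1, e2, e3⟩ :=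
      exact_one n r0 u v (mem_dlt.1 hu) (mem_dlt.1 hv) hc
    exact ⟨(y, (⟨p, mem_dlt.2 hp⟩, ⟨r, mem_dlt.2 hr⟩), (⟨p', mem_dlt.2 hp'⟩, ⟨r', mem_dlt.2 hr'⟩)),
      Prod.ext e1.symm (Prod.ext (Subtype.ext e2.symm) (Subtype.ext e3.symm))⟩

lemma f_exact2 (n : ℕ) : LinearMap.range (f3 (k := k) n) = LinearMap.ker (f2 n) := by
  apply le_antisymm
  · rintro _ ⟨c, rfl⟩
    exact Prod.ext (Phi2_zero n c.1 _ _ (mem_dlt.1 c.2.1.2) (mem_dlt.1 c.2.2.2))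
      (Prod.ext (Subtype.ext (PhiA_zero n _ _)) (Subtype.ext (PhiC_zero n _ _)))
  · rintro ⟨y, ⟨⟨p, hp⟩, ⟨r, hr⟩⟩, ⟨⟨p', hp'⟩, ⟨r', hr'⟩⟩⟩ hc
    have hA : PhiA (n + 1) y p r = 0 := congrArg (fun c => (c.2.1 : Polynomial RR)) hc
    have hC : PhiC (n + 1) y p' r' = 0 := congrArg (fun c => (c.2.2 : Polynomial RR)) hc
    obtain ⟨z, w, w', hw, hw', e1, e2, e3, e4, e5⟩ := exact_two n y p r p' r'
      (mem_dlt.1 hp) (mem_dlt.1 hr) (mem_dlt.1 hp') hA hC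
    exact ⟨(z, ⟨w, mem_dlt.2 hw⟩, ⟨w', mem_dlt.2 hw'⟩),
      Prod.ext e1.symm (Prod.ext (Prod.ext (Subtype.ext e2.symm) (Subtype.ext e3.symm))
        (Prod.ext (Subtype.ext e4.symm) (Subtype.ext e5.symm)))⟩

lemma f3_inj (n : ℕ) : Function.Injective (f3 (k := k) n) := by
  rw [injective_iff_map_eq_zero]
  rintro ⟨z, ⟨w, hw⟩, ⟨w', hw'⟩⟩ hc
  have hz : z * Q k = 0 := congrArg (fun c => c.1) hc
  have hA : Ap n z w = 0 := congrArg (fun c => (c.2.1.1 : Polynomial RR)) hc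
  have hC : Cp n z w' = 0 := congrArg (fun c => (c.2.2.1 : Polynomial RR)) hc
  obtain rfl := (mul_eq_zero.1 hz).resolve_right Q_ne
  simp only [Ap, Cp, map_zero, zero_mul, neg_zero, zero_add] at hA hC
  have h1 : w = 0 := (mul_eq_zero.1 hA).resolve_left (lin_ne_zero (X_ne_zero _))
  have h2 : w' = 0 := (mul_eq_zero.1 hC).resolve_left (lin_ne_zero (X_ne_zero _))
  exact Prod.ext rfl (Prod.ext (Subtype.ext h1) (Subtype.ext h2))

/-- irrelevant ideal -/
noncomputable abbrev mm (k : Type*) [Field k] : Ideal (MvPolynomial (Fin 5) k) :=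
  Ideal.span (Set.range (X : Fin 5 → MvPolynomial (Fin 5) k))

lemma X_mem (i : Fin 5) : (X i : RR) ∈ mm k := Ideal.subset_span ⟨i, rfl⟩
lemma X_mul_mem (i : Fin 5) (f : RR) : X i * f ∈ mm k := (mm k).mul_mem_right _ (X_mem i)

lemma C_bin_mem (y : RR) (n : ℕ) (a b : RR) (ha : a ∈ mm k) (hb : b ∈ mm k) (i : ℕ) :
    (Polynomial.C y * bin n a b).coeff i ∈ mm k := by
  rw [Polynomial.coeff_C_mul]
  exact (mm k).mul_mem_left _ (bin_mem _ _ _ _ ha hb i)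

lemma f1_min (h : ℕ) : LinearMap.range (f1 (k := k) h) ≤ mm k • (⊤ : Submodule RR RR) := by
  rintro _ ⟨c, rfl⟩
  apply mem_smul_ring
  refine (mm k).add_mem ((mm k).add_mem ((mm k).mul_mem_left _ ?_) ?_) ?_
  · exact (mm k).sub_mem (X_mul_mem _ _) (X_mul_mem _ _)
  · exact (mm k).sub_mem (X_mul_mem _ _) (X_mul_mem _ _)
  · exact (mm k).sub_mem (X_mul_mem _ _) (X_mul_mem _ _)

lemma Phi2_mem (n : ℕ) (p r p' r' : Polynomial RR) : Phi2 n p r p' r' ∈ mm k := by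
  unfold Phi2
  exact (mm k).neg_mem ((mm k).add_mem ((mm k).add_mem ((mm k).add_mem (X_mul_mem _ _)
      (X_mul_mem _ _)) (X_mul_mem _ _)) (X_mul_mem _ _))

lemma PhiA_mem (n : ℕ) (y : RR) (p r : Polynomial RR) (i : ℕ) :
    (PhiA n y p r).coeff i ∈ mm k := by
  simp only [PhiA, Polynomial.coeff_add, Polynomial.coeff_neg]
  exact (mm k).add_mem ((mm k).neg_mem (C_bin_mem _ _ _ _ (X_mem _) (X_mem _) i))
      ((mm k).add_mem (lin_mul_mem _ _ _ (X_mem _) (X_mem _) _ i)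
        (lin_mul_mem _ _ _ (X_mem _) (X_mem _) _ i))

lemma PhiC_mem (n : ℕ) (y : RR) (p r : Polynomial RR) (i : ℕ) :
    (PhiC n y p r).coeff i ∈ mm k := by
  simp only [PhiC, Polynomial.coeff_add]
  exact (mm k).add_mem (C_bin_mem _ _ _ _ (X_mem _) (X_mem _) i)
      ((mm k).add_mem (lin_mul_mem _ _ _ (X_mem _) (X_mem _) _ i)
        (lin_mul_mem _ _ _ (X_mem _) (X_mem _) _ i))

lemma f2_min (n : ℕ) : LinearMap.range (f2 (k := k) n) ≤
    mm k • (⊤ : Submodule RR (RR × DD (n + 2) × DD (n + 2))) := by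
  intro x hx
  obtain ⟨c, hc⟩ := hx
  rw [← hc]
  exact mem_smul_triple (mm k) (n + 2) (n + 2) (f2 n c) (Phi2_mem n _ _ _ _)
    (fun i => PhiA_mem (n + 1) _ _ _ i) (fun i => PhiC_mem (n + 1) _ _ _ i)

lemma Ap_mem (n : ℕ) (y : RR) (w : Polynomial RR) (i : ℕ) : (Ap n y w).coeff i ∈ mm k := by
  simp only [Ap, Polynomial.coeff_add, Polynomial.coeff_neg]
  exact (mm k).add_mem ((mm k).neg_mem (C_bin_mem _ _ _ _ (X_mul_mem _ _) (X_mul_mem _ _) i))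
      (lin_mul_mem _ _ _ (X_mem _) (X_mem _) _ i)

lemma Ar_mem (n : ℕ) (y : RR) (w : Polynomial RR) (i : ℕ) : (Ar n y w).coeff i ∈ mm k := by
  simp only [Ar, Polynomial.coeff_sub]
  exact (mm k).sub_mem (C_bin_mem _ _ _ _ (X_mul_mem _ _) (X_mul_mem _ _) i)
      (lin_mul_mem _ _ _ (X_mem _) (X_mem _) _ i)

lemma Cp_mem (n : ℕ) (y : RR) (w : Polynomial RR) (i : ℕ) : (Cp n y w).coeff i ∈ mm k := by
  simp only [Cp, Polynomial.coeff_add, Polynomial.coeff_neg]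
  exact (mm k).add_mem ((mm k).neg_mem (C_bin_mem _ _ _ _ (X_mul_mem _ _) (X_mul_mem _ _) i))
      (lin_mul_mem _ _ _ (X_mem _) (X_mem _) _ i)

lemma Cr_mem (n : ℕ) (y : RR) (w : Polynomial RR) (i : ℕ) : (Cr n y w).coeff i ∈ mm k := by
  simp only [Cr, Polynomial.coeff_sub]
  exact (mm k).sub_mem (C_bin_mem _ _ _ _ (X_mul_mem _ _) (X_mul_mem _ _) i)
      (lin_mul_mem _ _ _ (X_mem _) (X_mem _) _ i)

lemma f3_min (n : ℕ) : LinearMap.range (f3 (k := k) n) ≤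
    mm k • (⊤ : Submodule RR (RR × (DD (n + 1) × DD (n + 1)) × (DD (n + 1) × DD (n + 1)))) := by
  intro x hx
  obtain ⟨c, hc⟩ := hx
  rw [← hc]
  have hQ : c.1 * Q k ∈ mm k :=
    (mm k).mul_mem_left _ ((mm k).sub_mem (X_mul_mem _ _) (X_mul_mem _ _))
  exact mem_smul_five (mm k) (n + 1) (f3 n c) hQ (fun i => Ap_mem n _ _ i)
    (fun i => Ar_mem n _ _ i) (fun i => Cp_mem n _ _ i) (fun i => Cr_mem n _ _ i)

lemma f1_range (h : ℕ) (hh : 0 < h) (τ : RR →ₐ[k] MvPolynomial (Fin 2) k)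
    (t0 : τ (X 0) = X 0 ^ ((h + 1) ^ 2 + 1))
    (t1 : τ (X 1) = X 0 ^ (h + 2) * X 1 ^ (h * (h + 1)))
    (t2 : τ (X 2) = X 0 ^ (h + 1) * X 1 ^ (h * (h + 1) + 1))
    (t3 : τ (X 3) = X 0 * X 1 ^ ((h + 1) ^ 2))
    (t4 : τ (X 4) = X 1 ^ ((h + 1) ^ 2 + 1)) :
    LinearMap.range (f1 (k := k) h) = RingHom.ker τ.toRingHom := by
  apply le_antisymm
  · rintro _ ⟨c, rfl⟩
    rw [RingHom.mem_ker]
    change τ.toRingHom (c.1 * Q k + PhiF h c.2.1 + PhiG h c.2.2) = 0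
    have a1 : τ.toRingHom (X 1) = (X 0 ^ (h + 1) * X 1 ^ (h * (h + 1))) * X 0 := by
      change τ (X 1) = _; rw [t1]; ring
    have a2 : τ.toRingHom (X 2) = (X 0 ^ (h + 1) * X 1 ^ (h * (h + 1))) * X 1 := by
      change τ (X 2) = _; rw [t2]; ring
    have a3 : τ.toRingHom (X 3) = X 1 ^ ((h + 1) ^ 2) * X 0 := by
      change τ (X 3) = _; rw [t3]; ring
    have a4 : τ.toRingHom (X 4) = X 1 ^ ((h + 1) ^ 2) * X 1 := by
      change τ (X 4) = _; rw [t4]; ring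
    have a0 : τ.toRingHom (X 0) = X 0 ^ ((h + 1) ^ 2 + 1) := t0
    have aQ : τ.toRingHom (Q k) = 0 := by
      rw [Q, map_sub, map_mul, map_mul, a1, a2, a3, a4]; ring
    rw [map_add, map_add, map_mul, aQ, map_PhiF _ a1 a2 a3 a4, map_PhiG _ a1 a2 a3 a4, a0]
    have z1 : (X 1 ^ ((h + 1) ^ 2) * X 0 ^ (h + 1) -
      X 0 ^ (h + 1) * X 1 ^ (h * (h + 1)) * X 1 ^ (h + 1) : MvPolynomial (Fin 2) k) = 0 := by ring
    have z2 : (X 0 ^ ((h + 1) ^ 2 + 1) * (X 1 ^ ((h + 1) ^ 2)) ^ h -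
      (X 0 ^ (h + 1) * X 1 ^ (h * (h + 1))) ^ (h + 1) * X 0 : MvPolynomial (Fin 2) k) = 0 := by ring
    rw [z1, z2]
    simp
  · intro f hf
    have xmem : ∀ i ≤ h, (Polynomial.X ^ i : Polynomial RR) ∈ DD (h + 1) := by
      intro i hi
      rw [mem_dlt]
      intro j hj
      rw [Polynomial.coeff_X_pow, if_neg (by omega)]
    refine toric_ker h hh (LinearMap.range (f1 (k := k) h)) ?_ ?_ ?_ τ t0 t1 t2 t3 t4 f hf
    · refine ⟨(1, 0, 0), ?_⟩
      simp [f1, PhiF, PhiG, Hm, Q]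
    · intro i hi
      refine ⟨(0, ⟨Polynomial.X ^ i, xmem i hi⟩, 0), ?_⟩
      change 0 * Q k + PhiF h (Polynomial.X ^ i) + PhiG h 0 = _
      rw [PhiF, Hm_X_pow _ _ _ _ _ hi, Hm_X_pow _ _ _ _ _ hi, Nat.sub_add_comm hi]
      simp [PhiG, Hm]
      ring
    · intro i hi
      refine ⟨(0, 0, ⟨Polynomial.X ^ i, xmem i hi⟩), ?_⟩
      change 0 * Q k + PhiF h 0 + PhiG h (Polynomial.X ^ i) = _
      rw [PhiG, Hm_X_pow _ _ _ _ _ hi, Hm_X_pow _ _ _ _ _ hi]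
      simp [PhiF, Hm]
      ring

end

lemma transport {R C1 C2 C3 D1 D2 D3 : Type*} [CommRing R] [AddCommGroup C1] [AddCommGroup C2]
    [AddCommGroup C3] [Module R C1] [Module R C2] [Module R C3]
    [AddCommGroup D1] [AddCommGroup D2] [AddCommGroup D3] [Module R D1] [Module R D2] [Module R D3]
    (I m : Ideal R) (f1 : C1 →ₗ[R] R) (f2 : C2 →ₗ[R] C1) (f3 : C3 →ₗ[R] C2)
    (e1 : C1 ≃ₗ[R] D1) (e2 : C2 ≃ₗ[R] D2) (e3 : C3 ≃ₗ[R] D3)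
    (h1 : LinearMap.range f1 = I) (h2 : LinearMap.range f2 = LinearMap.ker f1)
    (h3 : LinearMap.range f3 = LinearMap.ker f2) (h4 : Function.Injective f3)
    (m1 : LinearMap.range f1 ≤ m • (⊤ : Submodule R R)) (m2 : LinearMap.range f2 ≤ m • ⊤)
    (m3 : LinearMap.range f3 ≤ m • ⊤) :
    ∃ (φ₁ : D1 →ₗ[R] R) (φ₂ : D2 →ₗ[R] D1) (φ₃ : D3 →ₗ[R] D2),
      LinearMap.range φ₁ = I ∧
      LinearMap.range φ₂ = LinearMap.ker φ₁ ∧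
      LinearMap.range φ₃ = LinearMap.ker φ₂ ∧
      Function.Injective φ₃ ∧
      LinearMap.range φ₁ ≤ m • (⊤ : Submodule R R) ∧
      LinearMap.range φ₂ ≤ m • (⊤ : Submodule R D1) ∧
      LinearMap.range φ₃ ≤ m • (⊤ : Submodule R D2) := by
  have r1 : LinearMap.range (f1 ∘ₗ (e1.symm : D1 →ₗ[R] C1)) = LinearMap.range f1 :=
    LinearMap.range_comp_of_range_eq_top _ (LinearEquiv.range e1.symm)
  refine ⟨f1 ∘ₗ (e1.symm : D1 →ₗ[R] C1), (e1 : C1 →ₗ[R] D1) ∘ₗ f2 ∘ₗ (e2.symm : D2 →ₗ[R] C2),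
    (e2 : C2 →ₗ[R] D2) ∘ₗ f3 ∘ₗ (e3.symm : D3 →ₗ[R] C3), by rw [r1, h1], ?_, ?_, ?_,
    by rw [r1]; exact m1, ?_, ?_⟩
  · ext x
    have : e1.symm x ∈ LinearMap.range f2 ↔ e1.symm x ∈ LinearMap.ker f1 := by rw [h2]
    simp only [LinearMap.mem_range, LinearMap.mem_ker, LinearMap.comp_apply,
      LinearEquiv.coe_coe] at this ⊢
    rw [← this]
    constructor
    · rintro ⟨y, rfl⟩
      exact ⟨e2.symm y, by simp⟩
    · rintro ⟨y, hy⟩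
      exact ⟨e2 y, by simp [hy]⟩
  · ext x
    have : e2.symm x ∈ LinearMap.range f3 ↔ e2.symm x ∈ LinearMap.ker f2 := by rw [h3]
    simp only [LinearMap.mem_range, LinearMap.mem_ker, LinearMap.comp_apply,
      LinearEquiv.coe_coe, LinearEquiv.map_eq_zero_iff] at this ⊢
    rw [← this]
    constructor
    · rintro ⟨y, rfl⟩
      exact ⟨e3.symm y, by simp⟩
    · rintro ⟨y, hy⟩
      exact ⟨e3 y, by simp [hy]⟩
  · exact e2.injective.comp (h4.comp e3.symm.injective)
  · rintro _ ⟨y, rfl⟩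
    exact mem_smul_equiv m e1 (m2 ⟨_, rfl⟩)
  · rintro _ ⟨y, rfl⟩
    exact mem_smul_equiv m e2 (m3 ⟨_, rfl⟩)

end Arslan

/-- For `h ≥ 2`, the defining ideal `I` of the projective closure of the
Arslan curve `C(h(h+1), h(h+1)+1, (h+1)², (h+1)²+1)` (realized as the kernel of
`x₀ ↦ s^{n₄}`, `x_i ↦ s^{n₄-n_i} t^{n_i}` in `R = k[x₀,…,x₄]`) has a minimal
graded free resolution `0 → R^{2h-1} → R^{4h+1} → R^{2h+3} → R → R/I → 0`: its
Betti numbers are `2h+3, 4h+1, 2h-1`, the projective dimension of `R/I` is `3`,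
and the Cohen–Macaulay type is `2h-1`, an unbounded function of `h`. -/
theorem arslan_projective_closure_resolution
    (k : Type*) [Field k] (h : ℕ) (hh : 2 ≤ h) :
    letI n₁ : ℕ := h * (h + 1)
    letI n₂ : ℕ := h * (h + 1) + 1
    letI n₃ : ℕ := (h + 1) ^ 2
    letI n₄ : ℕ := (h + 1) ^ 2 + 1
    letI s : MvPolynomial (Fin 2) k := X 0
    letI t : MvPolynomial (Fin 2) k := X 1
    letI I : Ideal (MvPolynomial (Fin 5) k) :=
      RingHom.ker (aeval (R := k)
        ![s ^ n₄, s ^ (n₄ - n₁) * t ^ n₁, s ^ (n₄ - n₂) * t ^ n₂,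
          s ^ (n₄ - n₃) * t ^ n₃, t ^ n₄]).toRingHom
    letI R := MvPolynomial (Fin 5) k
    letI m : Ideal (MvPolynomial (Fin 5) k) :=
      Ideal.span (Set.range (X : Fin 5 → MvPolynomial (Fin 5) k))
    ∃ (φ₁ : (Fin (2 * h + 3) → R) →ₗ[R] R)
      (φ₂ : (Fin (4 * h + 1) → R) →ₗ[R] (Fin (2 * h + 3) → R))
      (φ₃ : (Fin (2 * h - 1) → R) →ₗ[R] (Fin (4 * h + 1) → R)),
      LinearMap.range φ₁ = (I : Submodule (MvPolynomial (Fin 5) k) R) ∧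
      LinearMap.range φ₂ = LinearMap.ker φ₁ ∧
      LinearMap.range φ₃ = LinearMap.ker φ₂ ∧
      Function.Injective φ₃ ∧
      LinearMap.range φ₁ ≤ m • (⊤ : Submodule R R) ∧
      LinearMap.range φ₂ ≤ m • (⊤ : Submodule R (Fin (2 * h + 3) → R)) ∧
      LinearMap.range φ₃ ≤ m • (⊤ : Submodule R (Fin (4 * h + 1) → R)) := by
  obtain ⟨n, rfl⟩ : ∃ n, h = n + 1 := ⟨h - 1, by omega⟩
  obtain ⟨e1⟩ := Arslan.exists_equiv (R := MvPolynomial (Fin 5) k) (n + 2) (n + 2)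
    (2 * (n + 1) + 3) (by omega)
  obtain ⟨e2⟩ := Arslan.exists_equiv4 (R := MvPolynomial (Fin 5) k) (n + 1)
    (4 * (n + 1) + 1) (by omega)
  obtain ⟨e3⟩ := Arslan.exists_equiv (R := MvPolynomial (Fin 5) k) n n
    (2 * (n + 1) - 1) (by omega)
  have d1 : (n + 1 + 1) ^ 2 + 1 - (n + 1) * (n + 1 + 1) = n + 1 + 2 :=
    Nat.sub_eq_of_eq_add (by ring)
  have d2 : (n + 1 + 1) ^ 2 + 1 - ((n + 1) * (n + 1 + 1) + 1) = n + 1 + 1 :=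
    Nat.sub_eq_of_eq_add (by ring)
  have d3 : (n + 1 + 1) ^ 2 + 1 - (n + 1 + 1) ^ 2 = 1 := Nat.sub_eq_of_eq_add (by ring)
  rw [d1, d2, d3]
  refine Arslan.transport _ _ (Arslan.f1 (n + 1)) (Arslan.f2 n) (Arslan.f3 n) e1 e2 e3 ?_
    (Arslan.f_exact1 n) (Arslan.f_exact2 n) (Arslan.f3_inj n) (Arslan.f1_min _)
    (Arslan.f2_min n) (Arslan.f3_min n)
  apply Arslan.f1_range (n + 1) (by omega)
  · rw [aeval_X]; rfl
  · rw [aeval_X]; rfl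
  · rw [aeval_X]; rfl
  · rw [aeval_X]
    change X 0 ^ 1 * _ = _
    rw [pow_one]
  · rw [aeval_X]; rfl
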